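/- Let n ∈ ℕ, E a complex Banach space, s ∈ ℝ, 0 < p ≤ ∞, 0 < q ≤ ∞, d > 1. Let K ∈ ℕ₀ and L ∈ ℤ with L ≥ −1 satisfy K ≥ 1 + ⌊s⌋ and L ≥ ⌊σ_p − s⌋. Then there is a constant c > 0 such that: every f ∈ S'(ℝ^n,E) which can be represented as f = Σ_{ν=0}^∞ Σ_{m∈ℤ^n} λ_{ν,m} a_{ν,m} with convergence in S'(ℝ^n,E), where each a_{0,m} is an E-valued 1_K-atom supported in d·Q_{0,m} and each a_{ν,m} (ν ≥ 1) is an E-valued (s,p)_{K,L}-atom associated with Q_{ν,m}, and where λ ∈ b_{p,q}, belongs to B^s_{p,q}(E) and satisfies ‖f|B^s_{p,q}(E)‖ ≤ c ‖λ|b_{p,q}‖. The constant c is independent of f, of the coefficients λ and of the atoms a_{ν,m}, i.e. of the chosen representation. -/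

import Mathlib

noncomputable section

open MeasureTheory Filter Metric Real Set SchwartzMap
open scoped ENNReal NNReal Topology FourierTransform

/-- Euclidean space ℝⁿ. -/
abbrev Rn (n : ℕ) : Type := EuclideanSpace ℝ (Fin n)

/-- The Schwartz space 𝓢(ℝⁿ, ℂ). -/
abbrev Sch (n : ℕ) : Type := SchwartzMap (Rn n) ℂ

/-- Partial derivative in the `i`-th coordinate direction. -/
def pd {F : Type*} [NormedAddCommGroup F] [NormedSpace ℝ F] {n : ℕ} (i : Fin n)
    (g : Rn n → F) : Rn n → F :=
  fun x => lineDeriv ℝ g x (EuclideanSpace.single i (1 : ℝ))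

/-- Multi-index derivative `D^α = ∂₁^{α₁} ⋯ ∂ₙ^{αₙ}`. -/
def mderiv {F : Type*} [NormedAddCommGroup F] [NormedSpace ℝ F] {n : ℕ} (α : Fin n → ℕ)
    (g : Rn n → F) : Rn n → F :=
  (List.finRange n).foldr (fun i h => (pd i)^[α i] h) g

/-- The order `|α|` of a multi-index. -/
def mdeg {n : ℕ} (α : Fin n → ℕ) : ℕ := ∑ i, α i

/-- The Schwartz seminorm `‖φ‖_{K,L} = sup_x (1+|x|²)^{K/2} ∑_{|α| ≤ L} |D^α φ(x)|`. -/
def schSemi {n : ℕ} (K L : ℕ) (φ : Sch n) : ℝ :=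
  ⨆ x : Rn n, (1 + ‖x‖ ^ 2) ^ ((K : ℝ) / 2) *
    ∑ α : Fin n → Fin (L + 1), if mdeg (fun i => (α i : ℕ)) ≤ L
      then ‖mderiv (fun i => (α i : ℕ)) (fun y => φ y) x‖ else 0

/-- `E`-valued tempered distributions: linear maps `𝓢(ℝⁿ) → E` bounded by some
Schwartz seminorm. -/
structure TDist (n : ℕ) (E : Type*) [NormedAddCommGroup E] [NormedSpace ℂ E] where
  toFun : Sch n →ₗ[ℂ] E
  bound : ∃ (c : ℝ) (K L : ℕ), ∀ φ : Sch n, ‖toFun φ‖ ≤ c * schSemi K L φ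

namespace Aux

lemma hasTemperateGrowth_sub_left {n : ℕ} (x : Rn n) :
    Function.HasTemperateGrowth (fun y : Rn n => x - y) := by
  apply Function.HasTemperateGrowth.of_fderiv (k := 1) (C := ‖x‖ + 1)
  · have h : (fderiv ℝ (fun y : Rn n => x - y)) =
        fun _ : Rn n => -(ContinuousLinearMap.id ℝ (Rn n)) := by
      ext1 y
      rw [fderiv_const_sub]
      simp
    rw [h]
    exact .const _
  · exact (differentiable_const x).sub differentiable_id
  · intro y
    have h1 : ‖x - y‖ ≤ ‖x‖ + ‖y‖ := norm_sub_le x y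
    have h2 : (0:ℝ) ≤ ‖y‖ := norm_nonneg y
    have h3 : (0:ℝ) ≤ ‖x‖ := norm_nonneg x
    calc ‖x - y‖ ≤ ‖x‖ + ‖y‖ := h1
      _ ≤ (‖x‖ + 1) * (1 + ‖y‖) ^ 1 := by nlinarith

lemma antilipschitz_sub_left {n : ℕ} (x : Rn n) :
    AntilipschitzWith 1 (fun y : Rn n => x - y) := by
  refine (Isometry.antilipschitz ?_)
  intro y z
  simp only [edist_dist, dist_eq_norm, sub_sub_sub_cancel_left, norm_sub_rev]

end Aux

/-- The Schwartz function `y ↦ ψ(x - y)`. -/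
def shiftReflect {n : ℕ} (ψ : Sch n) (x : Rn n) : Sch n :=
  SchwartzMap.compCLMOfAntilipschitz (𝕜 := ℝ)
    (Aux.hasTemperateGrowth_sub_left x) (Aux.antilipschitz_sub_left x) ψ

/-- The dilated Schwartz function `ψ(t ·)` (junk value `0` when `t = 0`). -/
def dilate {n : ℕ} (ψ : Sch n) (t : ℝ) : Sch n :=
  if h : t = 0 then 0 else
    SchwartzMap.compCLM (𝕜 := ℝ) (g := fun y : Rn n => t • y)
      (by
        have := (t • ContinuousLinearMap.id ℝ (Rn n)).hasTemperateGrowth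
        exact this)
      (⟨1, |t|⁻¹, fun y => by
        have ht : 0 < |t| := abs_pos.mpr h
        have : ‖t • y‖ = |t| * ‖y‖ := by rw [norm_smul]; simp [Real.norm_eq_abs]
        rw [pow_one, this]
        rw [mul_add, mul_one]
        have : |t|⁻¹ * (|t| * ‖y‖) = ‖y‖ := by field_simp
        nlinarith [norm_nonneg y, inv_pos.mpr ht]⟩) ψ

/-- Fourier transform on Schwartz space. -/
def fourierS {n : ℕ} (φ : Sch n) : Sch n := FourierTransform.fourierCLE ℂ (Sch n) φ

/-- Inverse Fourier transform on Schwartz space. -/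
def invFourierS {n : ℕ} (φ : Sch n) : Sch n := (FourierTransform.fourierCLE ℂ (Sch n)).symm φ

variable {n : ℕ} {E : Type*} [NormedAddCommGroup E] [NormedSpace ℂ E]

/-- Convolution `(ψ * f)(x) := (2π)^{-n/2} f(ψ(x - ·))` of a Schwartz function with an
`E`-valued tempered distribution. -/
def tdConv (ψ : Sch n) (f : TDist n E) : Rn n → E :=
  fun x => ((2 * π) ^ (-(n : ℝ) / 2) : ℝ) • f.toFun (shiftReflect ψ x)

/-- The operator `f ↦ (φ f̂)ˇ = φ̌ * f`. -/
def mOp (φ : Sch n) (f : TDist n E) : Rn n → E := tdConv (invFourierS φ) f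

/-- `L_p`-norm (in `[0,∞]`) of an `ℝ≥0∞`-valued function. -/
def lpNormENN {n : ℕ} (p : ℝ≥0∞) (g : Rn n → ℝ≥0∞) : ℝ≥0∞ :=
  if p = ∞ then essSup g volume else (∫⁻ x, (g x) ^ p.toReal) ^ (1 / p.toReal)

/-- `ℓ_q`-norm (in `[0,∞]`) of a sequence, with the usual modification for `q = ∞`. -/
def lqSum (q : ℝ≥0∞) (a : ℕ → ℝ≥0∞) : ℝ≥0∞ :=
  if q = ∞ then ⨆ j, a j else (∑' j, (a j) ^ q.toReal) ^ (1 / q.toReal)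

/-- A smooth dyadic resolution of unity. -/
structure SmoothResolution (n : ℕ) (φ : ℕ → Sch n) : Prop where
  supp0 : Function.support (φ 0) ⊆ {ξ : Rn n | ‖ξ‖ ≤ 2}
  suppj : ∀ j : ℕ, 0 < j →
    Function.support (φ j) ⊆ {ξ : Rn n | 2 ^ ((j : ℝ) - 1) ≤ ‖ξ‖ ∧ ‖ξ‖ ≤ 2 ^ ((j : ℝ) + 1)}
  sum_eq : ∀ ξ : Rn n, ∑' j : ℕ, φ j ξ = 1
  deriv_bound : ∀ α : Fin n → ℕ, ∃ c : ℝ, ∀ (j : ℕ) (ξ : Rn n),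
    ‖mderiv α (fun y => φ j y) ξ‖ ≤ c * 2 ^ (-(j : ℝ) * (mdeg α : ℝ))

/-- The Besov quasi-norm `‖f | B^s_{p,q}(E)‖` w.r.t. the resolution of unity `φ`. -/
def besovNorm (s : ℝ) (p q : ℝ≥0∞) (φ : ℕ → Sch n) (f : TDist n E) : ℝ≥0∞ :=
  lqSum q fun j => (2 : ℝ≥0∞) ^ ((j : ℝ) * s) * eLpNorm (mOp (φ j) f) p volume

/-- The Triebel–Lizorkin quasi-norm `‖f | F^s_{p,q}(E)‖` w.r.t. the resolution of unity `φ`. -/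
def triebelNorm (s : ℝ) (p q : ℝ≥0∞) (φ : ℕ → Sch n) (f : TDist n E) : ℝ≥0∞ :=
  lpNormENN p fun x =>
    lqSum q fun j => (2 : ℝ≥0∞) ^ ((j : ℝ) * s) * (‖mOp (φ j) f x‖₊ : ℝ≥0∞)

/-- The closed cube `d·Q_{ν,m}` with centre `2^{-ν}m` and side length `d·2^{-ν}`. -/
def dQ {n : ℕ} (d : ℝ) (ν : ℕ) (m : Fin n → ℤ) : Set (Rn n) :=
  {x : Rn n | ∀ i, |x i - 2 ^ (-(ν : ℝ)) * (m i : ℝ)| ≤ d * 2 ^ (-(ν : ℝ)) / 2}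

/-- The lattice point `m ∈ ℤⁿ` as a point of `ℝⁿ`. -/
def zpt {n : ℕ} (m : Fin n → ℤ) : Rn n := WithLp.toLp 2 fun i => (m i : ℝ)

/-- `σ_p = n(1/p - 1)_+`. -/
def sigmaP (n : ℕ) (p : ℝ≥0∞) : ℝ := max ((n : ℝ) * (1 / p.toReal - 1)) 0

/-- `σ_{p,q} = n(1/min(p,q) - 1)_+`. -/
def sigmaPQ (n : ℕ) (p q : ℝ≥0∞) : ℝ := max ((n : ℝ) * (1 / (min p q).toReal - 1)) 0

/-- An `E`-valued `1_K`-atom supported in `d·Q_{0,m}`. -/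
def Is1Atom {n : ℕ} {E : Type*} [NormedAddCommGroup E] [NormedSpace ℝ E]
    (K : ℕ) (d : ℝ) (m : Fin n → ℤ) (a : Rn n → E) : Prop :=
  ContDiff ℝ K a ∧ Function.support a ⊆ dQ d 0 m ∧
    ∀ α : Fin n → ℕ, mdeg α ≤ K → ∀ x, ‖mderiv α a x‖ ≤ 1

/-- An `E`-valued `(s,p)_{K,L}`-atom associated with the cube `Q_{ν,m}` (support in
`d·Q_{ν,m}`, derivative bounds, and moment conditions up to order `L`). -/
def IsSPAtom {n : ℕ} {E : Type*} [NormedAddCommGroup E] [NormedSpace ℝ E]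
    (s : ℝ) (p : ℝ≥0∞) (K : ℕ) (L : ℤ) (d : ℝ) (ν : ℕ) (m : Fin n → ℤ)
    (a : Rn n → E) : Prop :=
  ContDiff ℝ K a ∧ Function.support a ⊆ dQ d ν m ∧
    (∀ α : Fin n → ℕ, mdeg α ≤ K → ∀ x,
      ‖mderiv α a x‖ ≤ 2 ^ (-(ν : ℝ) * (s - (n : ℝ) / p.toReal) + (mdeg α : ℝ) * (ν : ℝ))) ∧
    ∀ β : Fin n → ℕ, (mdeg β : ℤ) ≤ L →
      (∫ x : Rn n, (∏ i, (x i) ^ (β i)) • a x) = 0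

/-- The sequence space norm `‖λ|b_{p,q}‖`. -/
def bNorm {n : ℕ} (p q : ℝ≥0∞) (lam : ℕ → (Fin n → ℤ) → ℂ) : ℝ≥0∞ :=
  lqSum q fun ν =>
    if p = ∞ then ⨆ m : Fin n → ℤ, (‖lam ν m‖₊ : ℝ≥0∞)
    else (∑' m : Fin n → ℤ, (‖lam ν m‖₊ : ℝ≥0∞) ^ p.toReal) ^ (1 / p.toReal)

open Classical in
/-- The `L_p`-normalised characteristic function `χ^{(p)}_{ν,m}` of `Q_{ν,m}`. -/
def chiP {n : ℕ} (p : ℝ≥0∞) (ν : ℕ) (m : Fin n → ℤ) (x : Rn n) : ℝ≥0∞ :=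
  if x ∈ dQ 1 ν m then (2 : ℝ≥0∞) ^ ((ν : ℝ) * (n : ℝ) / p.toReal) else 0

/-- The sequence space norm `‖λ|f_{p,q}‖`. -/
def fNorm {n : ℕ} (p q : ℝ≥0∞) (lam : ℕ → (Fin n → ℤ) → ℂ) : ℝ≥0∞ :=
  lpNormENN p fun x =>
    if q = ∞ then ⨆ (ν : ℕ) (m : Fin n → ℤ), (‖lam ν m‖₊ : ℝ≥0∞) * chiP p ν m x
    else (∑' (ν : ℕ) (m : Fin n → ℤ),
      ((‖lam ν m‖₊ : ℝ≥0∞) * chiP p ν m x) ^ q.toReal) ^ (1 / q.toReal)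

/-- `f = ∑_{ν,m} λ_{ν,m} a_{ν,m}` with unconditional convergence in `S'(ℝⁿ,E)`:
for every test function the pairings sum to `f(φ)`. -/
def RepresentsAtomic {n : ℕ} {E : Type*} [NormedAddCommGroup E] [NormedSpace ℂ E]
    (f : TDist n E) (lam : ℕ → (Fin n → ℤ) → ℂ)
    (a : ℕ → (Fin n → ℤ) → Rn n → E) : Prop :=
  ∀ φ : Sch n, HasSum
    (fun νm : ℕ × (Fin n → ℤ) => lam νm.1 νm.2 • ∫ x : Rn n, φ x • a νm.1 νm.2 x)
    (f.toFun φ)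

section PartA
variable {n : ℕ} {F : Type*} [NormedAddCommGroup F] [NormedSpace ℝ F]

def pdl (l : List (Fin n)) (g : Rn n → F) : Rn n → F := l.foldr (fun i h => pd i h) g

def bv (i : Fin n) : Rn n := EuclideanSpace.single i (1 : ℝ)

lemma pd_eq_fderiv {g : Rn n → F} (hg : Differentiable ℝ g) (i : Fin n) :
    pd i g = fun x => fderiv ℝ g x (bv i) := by
  ext x
  exact (hg x).lineDeriv_eq_fderiv

lemma contDiff_pd {g : Rn n → F} {k : ℕ} (hg : ContDiff ℝ (k + 1 : ℕ) g) (i : Fin n) :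
    ContDiff ℝ k (pd i g) := by
  rw [pd_eq_fderiv (hg.differentiable (by simp))]
  exact (hg.fderiv_right (m := (k : ℕ)) (by norm_cast)).clm_apply contDiff_const

lemma contDiff_pdl {g : Rn n → F} (l : List (Fin n)) (k : ℕ)
    (hg : ContDiff ℝ (k + l.length : ℕ) g) : ContDiff ℝ k (pdl l g) := by
  induction l generalizing k with
  | nil => simpa [pdl] using hg
  | cons i l ih =>
    apply contDiff_pd
    apply ih
    convert hg using 2
    simp; ring

lemma pd_comm {g : Rn n → F} (hg : ContDiff ℝ 2 g) (i j : Fin n) :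
    pd i (pd j g) = pd j (pd i g) := by
  have h1 : Differentiable ℝ g := hg.differentiable (by simp)
  have h2 : ∀ i, Differentiable ℝ (pd i g) := fun i =>
    (contDiff_pd (k := 1) (by simpa using hg) i).differentiable (by simp)
  have h3 : Differentiable ℝ (fderiv ℝ g) :=
    (hg.fderiv_right (m := 1) (by norm_num)).differentiable (by simp)
  rw [pd_eq_fderiv (h2 j), pd_eq_fderiv (h2 i), pd_eq_fderiv h1, pd_eq_fderiv h1]
  ext x
  have hs : IsSymmSndFDerivAt ℝ g x := hg.contDiffAt.isSymmSndFDerivAt (by simp)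
  have key : ∀ i j : Fin n, fderiv ℝ (fun x => fderiv ℝ g x (bv j)) x (bv i)
      = fderiv ℝ (fderiv ℝ g) x (bv i) (bv j) := by
    intro i j
    rw [fderiv_clm_apply (h3 x) (by fun_prop)]
    simp
  rw [key, key]
  exact hs _ _

lemma pdl_perm {g : Rn n → F} {l l' : List (Fin n)} (h : l.Perm l')
    (hg : ContDiff ℝ (l.length : ℕ) g) : pdl l g = pdl l' g := by
  induction h with
  | nil => rfl
  | cons x h ih =>
    have := ih (hg.of_le (by simp))
    simp only [pdl, List.foldr] at this ⊢
    rw [this]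
  | swap x y l =>
    simp only [pdl, List.foldr]
    apply pd_comm
    apply contDiff_pdl l 2
    convert hg using 2
    simp; ring
  | trans h1 h2 ih1 ih2 =>
    rw [ih1 hg, ih2 (by rw [← h1.length_eq]; exact hg)]

lemma mderiv_eq_pdl (α : Fin n → ℕ) (g : Rn n → F) :
    mderiv α g = pdl ((List.finRange n).flatMap fun i => List.replicate (α i) i) g := by
  unfold mderiv
  induction (List.finRange n) with
  | nil => rfl
  | cons i l ih =>
    simp only [List.foldr, List.flatMap_cons, pdl, List.foldr_append]
    rw [ih]
    simp only [pdl]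
    generalize List.foldr (fun i h => pd i h) g _ = h
    induction α i with
    | zero => rfl
    | succ k ihk => rw [Function.iterate_succ_apply', ihk]; rfl

lemma iteratedFDeriv_basis {k : ℕ} {g : Rn n → F} (hg : ContDiff ℝ k g) (r : Fin k → Fin n)
    (x : Rn n) :
    iteratedFDeriv ℝ k g x (fun l => bv (r l)) = pdl (List.ofFn r) g x := by
  induction k generalizing x with
  | zero => simp [pdl]
  | succ k ih =>
    have hd : Differentiable ℝ (iteratedFDeriv ℝ k g) :=
      hg.differentiable_iteratedFDeriv (by norm_cast; simp)
    rw [iteratedFDeriv_succ_apply_left, List.ofFn_succ]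
    change _ = pd (r 0) (pdl (List.ofFn fun i => r i.succ) g) x
    have h1 := fun x => ih (hg.of_le (by norm_cast; simp)) (fun i => r i.succ) x
    have h2 : pdl (List.ofFn fun i => r i.succ) g
        = fun x => iteratedFDeriv ℝ k g x (fun l => bv (r l.succ)) := by
      ext x; rw [h1]
    have h3 : Differentiable ℝ (fun x => iteratedFDeriv ℝ k g x (fun l => bv (r l.succ))) := by
      intro y
      exact ((hd y).continuousMultilinear_apply_const _)
    rw [h2, pd_eq_fderiv h3]
    have := fderiv_continuousMultilinear_apply_const_apply (hd x) (fun l => bv (r l.succ)) (bv (r 0))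
    exact this.symm

lemma norm_multilinear_le {k : ℕ} (T : ContinuousMultilinearMap ℝ (fun _ : Fin k => Rn n) F)
    {B : ℝ} (hB : 0 ≤ B) (h : ∀ r : Fin k → Fin n, ‖T (fun l => bv (r l))‖ ≤ B) :
    ‖T‖ ≤ (n : ℝ) ^ k * B := by
  apply ContinuousMultilinearMap.opNorm_le_bound (by positivity)
  intro v
  have hv : ∀ l, v l = ∑ i, (v l i) • bv i := by
    intro l
    ext a
    simp [bv, Pi.single_apply]
  have : T v = ∑ r : Fin k → Fin n, (∏ l, v l (r l)) • T (fun l => bv (r l)) := by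
    conv_lhs => rw [show v = fun l => ∑ i, (v l i) • bv i from funext hv]
    rw [ContinuousMultilinearMap.map_sum]
    refine Finset.sum_congr rfl fun r _ => ?_
    rw [ContinuousMultilinearMap.map_smul_univ]
  rw [this]
  calc ‖∑ r : Fin k → Fin n, (∏ l, v l (r l)) • T (fun l => bv (r l))‖
      ≤ ∑ r : Fin k → Fin n, ((∏ l, ‖v l‖) * B) := by
        refine norm_sum_le_of_le _ fun r _ => ?_
        rw [norm_smul]
        refine mul_le_mul ?_ (h r) (norm_nonneg _) (Finset.prod_nonneg fun _ _ => norm_nonneg _)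
        rw [norm_prod]
        exact Finset.prod_le_prod (fun _ _ => norm_nonneg _) fun l _ => PiLp.norm_apply_le (v l) (r l)
    _ = _ := by simp; ring

/-- multilinear expansion on the diagonal -/
lemma multilinear_expand {k : ℕ} (T : ContinuousMultilinearMap ℝ (fun _ : Fin k => Rn n) F)
    (y : Rn n) : T (fun _ => y) = ∑ r : Fin k → Fin n, (∏ l, y (r l)) • T (fun l => bv (r l)) := by
  have hv : y = ∑ i, (y i) • bv i := by
    ext a
    simp [bv, Pi.single_apply]
  conv_lhs => rw [hv]
  rw [ContinuousMultilinearMap.map_sum (f := T) (g := fun _ i => y i • bv i)]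
  refine Finset.sum_congr rfl fun r _ => ?_
  rw [ContinuousMultilinearMap.map_smul_univ]

lemma norm_iteratedFDeriv_le_mderiv {k : ℕ} {g : Rn n → F} (hg : ContDiff ℝ k g) (x : Rn n)
    {B : ℝ} (hB : 0 ≤ B) (h : ∀ α : Fin n → ℕ, mdeg α = k → ‖mderiv α g x‖ ≤ B) :
    ‖iteratedFDeriv ℝ k g x‖ ≤ (n : ℝ) ^ k * B := by
  apply norm_multilinear_le _ hB
  intro r
  rw [iteratedFDeriv_basis hg]
  have hlen : (List.ofFn r).length = k := by simp
  have hp : (List.ofFn r).Perm ((List.finRange n).flatMap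
      fun i => List.replicate ((List.ofFn r).count i) i) := by
    rw [List.perm_iff_count]
    intro a
    rw [List.count_flatMap]
    have : (List.map (List.count a ∘ fun i => List.replicate ((List.ofFn r).count i) i) (List.finRange n)).sum
        = ∑ i : Fin n, if i = a then (List.ofFn r).count i else 0 := by
      rw [← List.ofFn_eq_map, List.sum_ofFn]
      refine Finset.sum_congr rfl fun i _ => ?_
      simp [List.count_replicate]
    rw [this]
    simp
  rw [pdl_perm hp (by rw [hlen]; exact hg), ← mderiv_eq_pdl]
  apply h
  unfold mdeg
  have := hp.length_eq
  rw [hlen, List.length_flatMap] at this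
  refine Eq.trans ?_ this.symm
  rw [← List.ofFn_eq_map, List.sum_ofFn]
  simp

end PartA

section PartB
variable {n : ℕ}

lemma dilate_apply (ψ : Sch n) {t : ℝ} (ht : t ≠ 0) (y : Rn n) : dilate ψ t y = ψ (t • y) := by
  simp only [dilate, ht, dite_false]
  rfl

lemma dilate_coe (ψ : Sch n) {t : ℝ} (ht : t ≠ 0) : (dilate ψ t : Rn n → ℂ) = fun y => ψ (t • y) := by
  ext y; exact dilate_apply ψ ht y

lemma invFourierS_coe (φ : Sch n) (x : Rn n) : invFourierS φ x = 𝓕⁻ (φ : Rn n → ℂ) x := by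
  rw [← SchwartzMap.fourierInv_coe]
  rfl

lemma invFourierS_dilate (φ : Sch n) {t : ℝ} (ht : 0 < t) (x : Rn n) :
    invFourierS φ x = (t : ℂ) ^ n * invFourierS (dilate φ t) (t • x) := by
  rw [invFourierS_coe, invFourierS_coe, Real.fourierInv_eq, Real.fourierInv_eq]
  have h := Measure.integral_comp_smul (volume : Measure (Rn n))
    (fun v => Real.fourierChar (inner ℝ v x) • φ v) t
  have h2 : (fun v : Rn n => Real.fourierChar (inner ℝ v (t • x)) • dilate φ t v)
     = fun v => (fun v => Real.fourierChar (inner ℝ v x) • φ v) (t • v) := by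
    ext v
    simp only [dilate_apply φ ht.ne', inner_smul_left, inner_smul_right]
    simp
  rw [h2, h]
  rw [finrank_euclideanSpace_fin, abs_of_nonneg (by positivity), Complex.real_smul]
  push_cast
  rw [← mul_assoc, mul_inv_cancel₀ (by exact_mod_cast (pow_pos ht n).ne'), one_mul]

lemma resolution_bound {φ : ℕ → Sch n} (hφ : SmoothResolution n φ) (N : ℕ) :
    ∃ B : ℝ, 0 ≤ B ∧ ∀ j ξ, ‖iteratedFDeriv ℝ N (dilate (φ j) (2 ^ j)) ξ‖ ≤ B := by
  choose c hc using hφ.deriv_bound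
  let S : ℝ := ∑ α ∈ Finset.Icc (0 : Fin n → ℕ) (fun _ => N), |c α|
  have hS : 0 ≤ S := Finset.sum_nonneg fun _ _ => abs_nonneg _
  refine ⟨(n : ℝ) ^ N * S, by positivity, fun j ξ => ?_⟩
  have h2 : (2 : ℝ) ^ j ≠ 0 := by positivity
  rw [dilate_coe _ h2]
  have hsm : ContDiff ℝ N (φ j) := (φ j).smooth _
  have := iteratedFDeriv_comp_const_smul ((2 : ℝ) ^ j) hsm
  rw [this]
  simp only [norm_smul]
  have hb := norm_iteratedFDeriv_le_mderiv hsm ((2 : ℝ) ^ j • ξ) (B := S * 2 ^ (-(j : ℝ) * (N : ℝ)))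
    (by positivity) ?_
  · have e : (2 : ℝ) ^ (-(j : ℝ) * (N : ℝ)) = (((2 : ℝ) ^ j) ^ N)⁻¹ := by
      rw [neg_mul, Real.rpow_neg (by norm_num), ← pow_mul]
      norm_cast
    rw [e] at hb
    have h3 : ‖((2 : ℝ) ^ j) ^ N‖ = ((2 : ℝ) ^ j) ^ N := by
      rw [Real.norm_of_nonneg (by positivity)]
    rw [h3]
    calc _ ≤ ((2 : ℝ) ^ j) ^ N * ((n : ℝ) ^ N * (S * (((2 : ℝ) ^ j) ^ N)⁻¹)) := by gcongr
      _ = _ := by field_simp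
  · intro α hα
    have h4 := hc α j ((2 : ℝ) ^ j • ξ)
    rw [hα] at h4
    refine h4.trans ?_
    gcongr
    refine (le_abs_self _).trans ?_
    refine Finset.single_le_sum (f := fun α => |c α|) (fun _ _ => abs_nonneg _) ?_
    rw [Finset.mem_Icc]
    refine ⟨fun _ => Nat.zero_le _, fun i => ?_⟩
    rw [← hα]
    exact Finset.single_le_sum (f := fun i => α i) (fun _ _ => Nat.zero_le _) (Finset.mem_univ i)

lemma dilate_supp {φ : ℕ → Sch n} (hφ : SmoothResolution n φ) (j : ℕ) :
    tsupport (dilate (φ j) (2 ^ j)) ⊆ closedBall 0 2 := by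
  have h2 : (2 : ℝ) ^ j ≠ 0 := by positivity
  apply closure_minimal _ isClosed_closedBall
  intro ξ hξ
  rw [Function.mem_support, dilate_apply _ h2] at hξ
  rw [mem_closedBall_zero_iff]
  rcases Nat.eq_zero_or_pos j with rfl | hj
  · have := hφ.supp0 (Function.mem_support.2 hξ)
    simpa using this
  · have := (hφ.suppj j hj (Function.mem_support.2 hξ)).2
    rw [norm_smul, Real.norm_of_nonneg (by positivity), Real.rpow_add (by norm_num), Real.rpow_one,
      Real.rpow_natCast] at this
    exact le_of_mul_le_mul_left this (by positivity)

lemma dilate_seminorm {φ : ℕ → Sch n} (hφ : SmoothResolution n φ) (k N : ℕ) :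
    ∃ B : ℝ, 0 < B ∧ ∀ j, SchwartzMap.seminorm ℂ k N (dilate (φ j) (2 ^ j)) < B := by
  obtain ⟨B, hB0, hB⟩ := resolution_bound hφ N
  refine ⟨2 ^ k * B + 1, by positivity, fun j => ?_⟩
  refine lt_of_le_of_lt (SchwartzMap.seminorm_le_bound ℂ k N _ (M := 2 ^ k * B) (by positivity) ?_) (by linarith)
  intro x
  by_cases hx : iteratedFDeriv ℝ N (dilate (φ j) (2 ^ j)) x = 0
  · rw [hx]; simp; positivity
  · have := dilate_supp hφ j (support_iteratedFDeriv_subset N (Function.mem_support.2 hx))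
    rw [mem_closedBall_zero_iff] at this
    gcongr
    exact hB j x

lemma psi_bound {φ : ℕ → Sch n} (hφ : SmoothResolution n φ) (N M : ℕ) :
    ∃ C : ℝ, 0 < C ∧ ∀ j x, (1 + 2 ^ j * ‖x‖) ^ M * ‖iteratedFDeriv ℝ N (invFourierS (φ j)) x‖
      ≤ C * 2 ^ (j * (n + N)) := by
  have hvn : Bornology.IsVonNBounded ℂ (Set.range fun j => dilate (φ j) (2 ^ j)) := by
    rw [(schwartz_withSeminorms ℂ (Rn n) ℂ).isVonNBounded_iff_seminorm_bounded]
    rintro ⟨k, N⟩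
    obtain ⟨B, hB, h⟩ := dilate_seminorm hφ k N
    refine ⟨B, hB, ?_⟩
    rintro _ ⟨j, rfl⟩
    exact h j
  have hvn2 := hvn.image
    ((FourierTransform.fourierCLE ℂ (Sch n)).symm : Sch n →L[ℂ] Sch n)
  rw [(schwartz_withSeminorms ℂ (Rn n) ℂ).isVonNBounded_iff_seminorm_bounded] at hvn2
  choose r hr0 hr using hvn2
  let R : ℝ := ∑ i ∈ Finset.Iic (M, N), r i
  have hR : 0 < R := Finset.sum_pos (fun i _ => hr0 i) ⟨(M, N), by simp⟩
  have key : ∀ j x, (1 + ‖x‖) ^ M * ‖iteratedFDeriv ℝ N (invFourierS (dilate (φ j) (2 ^ j))) x‖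
      ≤ 2 ^ M * R := by
    intro j x
    refine (SchwartzMap.one_add_le_sup_seminorm_apply (𝕜 := ℂ) (m := (M, N)) le_rfl le_rfl _ _).trans ?_
    gcongr
    apply Seminorm.finset_sup_apply_le hR.le
    intro i hi
    refine (hr i _ ⟨_, ⟨j, rfl⟩, rfl⟩).le.trans ?_
    exact Finset.single_le_sum (fun i _ => (hr0 i).le) hi
  refine ⟨2 ^ M * R, by positivity, fun j x => ?_⟩
  have h2 : (0 : ℝ) < (2 : ℝ) ^ j := by positivity
  set g := invFourierS (dilate (φ j) (2 ^ j)) with hg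
  have e1 : (invFourierS (φ j) : Rn n → ℂ) = ((2 : ℝ) ^ j) ^ n • fun x => g ((2 : ℝ) ^ j • x) := by
    ext x
    rw [invFourierS_dilate _ h2, Pi.smul_apply, Complex.real_smul]
    push_cast
    rfl
  have hsm : ContDiff ℝ N g := g.smooth _
  have hsm2 : ContDiff ℝ N (fun x => g ((2 : ℝ) ^ j • x)) := by fun_prop
  rw [e1, iteratedFDeriv_const_smul_apply hsm2.contDiffAt, iteratedFDeriv_comp_const_smul _ hsm]
  simp only [norm_smul]
  rw [Real.norm_of_nonneg (by positivity : (0:ℝ) ≤ ((2 : ℝ) ^ j) ^ n),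
    Real.norm_of_nonneg (by positivity : (0:ℝ) ≤ ((2 : ℝ) ^ j) ^ N)]
  have := key j ((2 : ℝ) ^ j • x)
  rw [norm_smul, Real.norm_of_nonneg h2.le] at this
  calc _ = ((1 + 2 ^ j * ‖x‖) ^ M * ‖iteratedFDeriv ℝ N g ((2 : ℝ) ^ j • x)‖) * 2 ^ (j * (n + N)) := by
        rw [mul_add, pow_add, pow_mul, pow_mul]; ring
    _ ≤ _ := by gcongr

lemma psi_moment {φ : ℕ → Sch n} (hφ : SmoothResolution n φ) {j : ℕ} (hj : 0 < j) {k : ℕ}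
    (r : Fin k → Fin n) : ∫ y : Rn n, (∏ l, y (r l)) • invFourierS (φ j) y = 0 := by
  set ψ := invFourierS (φ j) with hψ
  have hF : 𝓕 (ψ : Rn n → ℂ) = φ j := by
    rw [← SchwartzMap.fourier_coe]
    congr 1
    exact (FourierTransform.fourierCLE ℂ (Sch n)).apply_symm_apply (φ j)
  have hz : iteratedFDeriv ℝ k (𝓕 (ψ : Rn n → ℂ)) 0 = 0 := by
    rw [hF]
    by_contra h
    have := support_iteratedFDeriv_subset k (Function.mem_support.2 h)
    have hcl : tsupport (φ j) ⊆ {ξ : Rn n | 2 ^ ((j : ℝ) - 1) ≤ ‖ξ‖} :=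
      closure_minimal (fun ξ hξ => (hφ.suppj j hj hξ).1) (isClosed_le continuous_const continuous_norm)
    have := hcl this
    simp only [mem_ofPred_eq, norm_zero] at this
    exact absurd this (not_le.2 (by positivity))
  have hI : ∀ (m : ℕ), (m : ℕ∞) ≤ (⊤ : ℕ∞) → Integrable (fun v => ‖v‖ ^ m * ‖ψ v‖) :=
    fun m _ => ψ.integrable_pow_mul volume m
  have hmeas : AEStronglyMeasurable (ψ : Rn n → ℂ) volume := ψ.continuous.aestronglyMeasurable
  rw [Real.iteratedFDeriv_fourier hI hmeas (n := k) le_top] at hz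
  have h0 := congrArg (fun T => T (fun l => bv (r l))) hz
  rw [Real.fourier_continuousMultilinearMap_apply
    (VectorFourier.integrable_fourierPowSMulRight _ (hI k le_top) hmeas), Real.fourier_eq] at h0
  simp only [inner_zero_right, neg_zero, AddChar.map_zero_eq_one, one_smul,
    VectorFourier.fourierPowSMulRight_apply] at h0
  rw [integral_smul] at h0
  have h1 := (smul_eq_zero.1 h0).resolve_left (by simp [Real.pi_ne_zero])
  rw [← h1]
  congr 1
  ext v
  congr 2
  ext l
  change _ = inner ℝ v (EuclideanSpace.single (r l) (1 : ℝ))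
  rw [EuclideanSpace.inner_single_right]
  simp
end PartB

section PartC
variable {n : ℕ}

lemma taylor_bound {F : Type*} [NormedAddCommGroup F] [NormedSpace ℝ F] [CompleteSpace F]
    {N : ℕ} {g : Rn n → F} (hg : ContDiff ℝ N g) (x h : Rn n) {B : ℝ}
    (hB : ∀ t ∈ Set.Icc (0 : ℝ) 1, ‖iteratedFDeriv ℝ N g (x + t • h)‖ ≤ B) :
    ‖g (x + h) - ∑ k ∈ Finset.range N, (k.factorial : ℝ)⁻¹ • iteratedFDeriv ℝ k g x (fun _ => h)‖
      ≤ B * ‖h‖ ^ N := by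
  rcases N with _ | N
  · have := hB 1 (by simp)
    simpa using this
  · have hB0 : 0 ≤ B := (norm_nonneg _).trans (hB 0 (by simp))
    rw [map_add_eq_sum_add_integral_iteratedFDeriv (f := g) (x := x) (y := h) (n := N) (fun t _ => by
      exact_mod_cast hg.contDiffAt), add_sub_cancel_left, norm_smul]
    have h1 : ‖∫ t in (0:ℝ)..1, (1 - t) ^ N • iteratedFDeriv ℝ (N + 1) g (x + t • h) (fun _ => h)‖
        ≤ (B * ‖h‖ ^ (N + 1)) * |1 - 0| := by
      apply intervalIntegral.norm_integral_le_of_norm_le_const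
      intro t ht
      rw [uIoc_of_le zero_le_one] at ht
      have h2 : ‖iteratedFDeriv ℝ (N + 1) g (x + t • h) (fun _ => h)‖ ≤ B * ‖h‖ ^ (N + 1) := by
        refine (ContinuousMultilinearMap.le_opNorm _ _).trans ?_
        simp only [Finset.prod_const, Finset.card_univ, Fintype.card_fin]
        gcongr
        exact hB t ⟨ht.1.le, ht.2⟩
      rw [norm_smul]
      have h3 : ‖(1 - t) ^ N‖ ≤ 1 := by
        rw [norm_pow]
        apply pow_le_one₀ (norm_nonneg _)
        rw [Real.norm_eq_abs, abs_le]
        constructor <;> linarith [ht.1, ht.2]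
      calc _ ≤ 1 * (B * ‖h‖ ^ (N + 1)) := by gcongr
        _ = _ := one_mul _
    have h4 : ‖((N.factorial : ℝ)⁻¹)‖ ≤ 1 := by
      rw [norm_inv, Real.norm_natCast]
      apply inv_le_one_of_one_le₀
      exact_mod_cast Nat.succ_le_of_lt N.factorial_pos
    calc _ ≤ 1 * ((B * ‖h‖ ^ (N + 1)) * |1 - 0|) := by gcongr
      _ = _ := by simp

variable {E : Type*} [NormedAddCommGroup E] [NormedSpace ℂ E]

lemma supp_deriv {a : Rn n → E} {c : Rn n} {D : ℝ} {ν : ℕ}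
    (hs : ∀ y, a y ≠ 0 → 2 ^ ν * ‖y - c‖ ≤ D) (N : ℕ) (z : Rn n)
    (hz : iteratedFDeriv ℝ N a z ≠ 0) : 2 ^ ν * ‖z - c‖ ≤ D := by
  have h1 : tsupport a ⊆ {y | 2 ^ ν * ‖y - c‖ ≤ D} :=
    closure_minimal (fun y hy => hs y hy) (isClosed_le (by fun_prop) continuous_const)
  exact h1 (support_iteratedFDeriv_subset N (Function.mem_support.2 hz))

lemma compact_supp {a : Rn n → E} {c : Rn n} {D : ℝ} {ν : ℕ}
    (hs : ∀ y, a y ≠ 0 → 2 ^ ν * ‖y - c‖ ≤ D) : HasCompactSupport a := by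
  apply HasCompactSupport.intro (isCompact_closedBall c (D / 2 ^ ν))
  intro y hy
  by_contra h
  apply hy
  rw [mem_closedBall, dist_eq_norm, le_div_iff₀ (by positivity), mul_comm]
  exact hs y h

lemma integrable_scaled (j : ℕ) :
    Integrable (fun y : Rn n => ((1 + 2 ^ j * ‖y‖) ^ (n + 1))⁻¹) ∧
    ∫ y : Rn n, ((1 + 2 ^ j * ‖y‖) ^ (n + 1))⁻¹
      = (2 ^ (j * n))⁻¹ * ∫ y : Rn n, ((1 + ‖y‖) ^ (n + 1))⁻¹ := by
  have h1 : Integrable (fun y : Rn n => ((1 + ‖y‖) ^ (n + 1))⁻¹) := by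
    have := integrable_one_add_norm (E := Rn n) (μ := volume) (r := (n + 1 : ℕ)) (by simp)
    refine this.congr (Eventually.of_forall fun y => ?_)
    simp only
    rw [Real.rpow_neg (by positivity), Real.rpow_natCast]
  have e : (fun y : Rn n => ((1 + 2 ^ j * ‖y‖) ^ (n + 1))⁻¹)
      = fun y => (fun y : Rn n => ((1 + ‖y‖) ^ (n + 1))⁻¹) ((2 : ℝ) ^ j • y) := by
    ext y
    simp only [norm_smul]
    rw [Real.norm_of_nonneg (by positivity)]
  rw [e]
  constructor
  · exact (integrable_comp_smul_iff volume _ (by positivity)).2 h1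
  · have h := Measure.integral_comp_smul (volume : Measure (Rn n))
      (fun y : Rn n => ((1 + ‖y‖) ^ (n + 1))⁻¹) ((2:ℝ)^j)
    refine h.trans ?_
    rw [finrank_euclideanSpace_fin, abs_of_nonneg (by positivity),
      smul_eq_mul, pow_mul]

lemma atom_high [CompleteSpace E] {φ : ℕ → Sch n} (hφ : SmoothResolution n φ) (N M : ℕ) (D : ℝ)
    (hD : 0 ≤ D) :
    ∃ C : ℝ, 0 < C ∧ ∀ (j ν : ℕ), ν ≤ j → (j = 0 → N = 0) → ∀ (a : Rn n → E) (c : Rn n) (A : ℝ),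
      0 ≤ A → ContDiff ℝ N a → (∀ x, ‖iteratedFDeriv ℝ N a x‖ ≤ A * 2 ^ (ν * N)) →
      (∀ y, a y ≠ 0 → 2 ^ ν * ‖y - c‖ ≤ D) → ∀ x,
      (1 + 2 ^ ν * ‖x - c‖) ^ M * ‖∫ y, invFourierS (φ j) (x - y) • a y‖ * 2 ^ (j * N)
        ≤ C * A * 2 ^ (ν * N) := by
  obtain ⟨C0, hC0, hpsi⟩ := psi_bound hφ 0 (N + M + (n + 1))
  set I : ℝ := ∫ y : Rn n, ((1 + ‖y‖) ^ (n + 1))⁻¹ with hI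
  have hI0 : 0 ≤ I := integral_nonneg fun y => by positivity
  refine ⟨(1 + D) ^ M * C0 * (I + 1), by positivity, ?_⟩
  intro j ν hνj hjN a c A hA ha hda hs x
  set ψ := invFourierS (φ j) with hψ
  have hcs := compact_supp hs
  have e1 : ∫ y, ψ (x - y) • a y = ∫ y, ψ y • a (x - y) := by
    rw [← integral_sub_left_eq_self (fun y => ψ y • a (x - y)) volume x]
    simp
  let T : Rn n → E := fun y => ∑ k ∈ Finset.range N, (k.factorial : ℝ)⁻¹ •
    iteratedFDeriv ℝ k a x (fun _ => -y)
  have hterm : ∀ k ∈ Finset.range N, Integrable (fun y => ψ y • ((k.factorial : ℝ)⁻¹ •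
    iteratedFDeriv ℝ k a x (fun _ => -y))) ∧ ∫ y, ψ y • ((k.factorial : ℝ)⁻¹ •
    iteratedFDeriv ℝ k a x (fun _ => -y)) = 0 := by
    intro k hk
    have hj : 0 < j := by
      rcases Nat.eq_zero_or_pos j with h | h
      · simp [hjN h] at hk
      · exact h
    have hterm2 : ∀ r : Fin k → Fin n, Integrable (fun y : Rn n => (∏ l, y (r l)) • ψ y) := by
      intro r
      refine (ψ.integrable_pow_mul volume k).mono' ?_ (Eventually.of_forall fun y => ?_)
      · refine Continuous.aestronglyMeasurable ?_
        have := ψ.continuous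
        fun_prop
      · rw [norm_smul, norm_prod]
        gcongr
        calc _ ≤ ∏ l : Fin k, ‖y‖ :=
              Finset.prod_le_prod (fun _ _ => norm_nonneg _) fun l _ => PiLp.norm_apply_le y (r l)
          _ = _ := by simp
    have e : (fun y : Rn n => ψ y • ((k.factorial : ℝ)⁻¹ • iteratedFDeriv ℝ k a x (fun _ => -y)))
      = fun y => ∑ r : Fin k → Fin n, ((∏ l, y (r l)) • ψ y) •
        ((-1 : ℝ) ^ k • (k.factorial : ℝ)⁻¹ • iteratedFDeriv ℝ k a x (fun l => bv (r l))) := by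
      ext y
      rw [multilinear_expand, Finset.smul_sum, Finset.smul_sum]
      refine Finset.sum_congr rfl fun r _ => ?_
      have : (∏ l, (-y) (r l)) = (-1 : ℝ) ^ k * ∏ l, y (r l) := by
        simp [Finset.prod_neg]
      rw [this, smul_assoc, smul_comm (∏ l, y (r l)) (ψ y)]
      congr 1
      simp only [smul_smul]
      congr 1
      ring
    rw [e]
    constructor
    · exact integrable_finsetSum _ fun r _ => (hterm2 r).smul_const _
    · rw [integral_finsetSum _ fun r _ => (hterm2 r).smul_const _]
      refine Finset.sum_eq_zero fun r _ => ?_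
      rw [integral_smul_const, psi_moment hφ hj r, zero_smul]
  have hTint : Integrable (fun y => ψ y • T y) := by
    simp only [T, Finset.smul_sum]
    exact integrable_finsetSum _ fun k hk => (hterm k hk).1
  have hT0 : ∫ y, ψ y • T y = 0 := by
    simp only [T, Finset.smul_sum]
    rw [integral_finsetSum _ fun k hk => (hterm k hk).1]
    exact Finset.sum_eq_zero fun k hk => (hterm k hk).2
  have haint : Integrable (fun y => ψ y • a (x - y)) := by
    apply Continuous.integrable_of_hasCompactSupport
    · have := ψ.continuous
      have := ha.continuous
      fun_prop
    · apply HasCompactSupport.smul_left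
      exact hcs.comp_homeomorph (Homeomorph.subLeft x)
  have e2 : ∫ y, ψ y • a (x - y) = ∫ y, ψ y • (a (x - y) - T y) := by
    simp only [smul_sub]
    rw [integral_sub haint hTint, hT0, sub_zero]
  have hP : 0 < 1 + 2 ^ ν * ‖x - c‖ := by positivity
  have hR : ∀ y, ‖a (x - y) - T y‖ ≤
      (A * 2 ^ (ν * N) * (((1 + D) * (1 + 2 ^ ν * ‖y‖)) / (1 + 2 ^ ν * ‖x - c‖)) ^ M) * ‖y‖ ^ N := by
    intro y
    have := taylor_bound ha x (-y)
      (B := A * 2 ^ (ν * N) * (((1 + D) * (1 + 2 ^ ν * ‖y‖)) / (1 + 2 ^ ν * ‖x - c‖)) ^ M) ?_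
    · rw [norm_neg, ← sub_eq_add_neg] at this
      exact this
    · intro t ht
      by_cases hz : iteratedFDeriv ℝ N a (x + t • -y) = 0
      · rw [hz, norm_zero]; positivity
      · have h1 := supp_deriv hs N _ hz
        have h2 : ‖x - c‖ ≤ ‖x + t • -y - c‖ + ‖y‖ := by
          have : x - c = (x + t • -y - c) + t • y := by simp; abel
          rw [this]
          refine (norm_add_le _ _).trans ?_
          have h3 : ‖t • y‖ ≤ 1 * ‖y‖ := by
            rw [norm_smul, Real.norm_of_nonneg ht.1]
            gcongr
            exact ht.2
          simpa using h3
        refine (hda _).trans (le_mul_of_one_le_right (by positivity) (one_le_pow₀ ?_))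
        rw [one_le_div hP]
        have h4 : 2 ^ ν * ‖x - c‖ ≤ 2 ^ ν * ‖x + t • -y - c‖ + 2 ^ ν * ‖y‖ := by
          rw [← mul_add]; gcongr
        have h5 : 0 ≤ D * (2 ^ ν * ‖y‖) := by positivity
        linarith
  have hbd : ∀ y, ‖ψ y • (a (x - y) - T y)‖ ≤
      (A * 2 ^ (ν * N) * (1 + D) ^ M * C0 * 2 ^ (j * n) / ((1 + 2 ^ ν * ‖x - c‖) ^ M * 2 ^ (j * N))) *
        ((1 + 2 ^ j * ‖y‖) ^ (n + 1))⁻¹ := by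
    intro y
    rw [norm_smul]
    have h1 := hpsi j y
    rw [norm_iteratedFDeriv_zero, add_zero] at h1
    have h2 : ‖ψ y‖ ≤ C0 * 2 ^ (j * n) / (1 + 2 ^ j * ‖y‖) ^ (N + M + (n + 1)) := by
      rw [le_div_iff₀ (by positivity), mul_comm]; exact h1
    have h3 : (2:ℝ) ^ ν ≤ 2 ^ j := pow_le_pow_right₀ (by norm_num) hνj
    have h4 : (1 + 2 ^ ν * ‖y‖) ^ M ≤ (1 + 2 ^ j * ‖y‖) ^ M := by gcongr
    have h5 : ‖y‖ ^ N ≤ (1 + 2 ^ j * ‖y‖) ^ N / 2 ^ (j * N) := by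
      rw [le_div_iff₀ (by positivity), pow_mul, ← mul_pow]
      gcongr
      linarith [mul_comm ‖y‖ (2 ^ j)]
    calc _ ≤ (C0 * 2 ^ (j * n) / (1 + 2 ^ j * ‖y‖) ^ (N + M + (n + 1))) *
          ((A * 2 ^ (ν * N) * (((1 + D) * (1 + 2 ^ ν * ‖y‖)) / (1 + 2 ^ ν * ‖x - c‖)) ^ M) * ‖y‖ ^ N) := by
            gcongr; exact hR y
      _ = (C0 * 2 ^ (j * n) / (1 + 2 ^ j * ‖y‖) ^ (N + M + (n + 1))) *
          ((A * 2 ^ (ν * N) * ((1 + D) ^ M * (1 + 2 ^ ν * ‖y‖) ^ M / (1 + 2 ^ ν * ‖x - c‖) ^ M)) * ‖y‖ ^ N) := by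
            rw [div_pow, mul_pow]
      _ ≤ (C0 * 2 ^ (j * n) / (1 + 2 ^ j * ‖y‖) ^ (N + M + (n + 1))) *
          ((A * 2 ^ (ν * N) * ((1 + D) ^ M * (1 + 2 ^ j * ‖y‖) ^ M / (1 + 2 ^ ν * ‖x - c‖) ^ M)) *
            ((1 + 2 ^ j * ‖y‖) ^ N / 2 ^ (j * N))) := by
            gcongr
      _ = _ := by
        have : 0 < 1 + 2 ^ j * ‖y‖ := by positivity
        rw [pow_add, pow_add]
        field_simp
  obtain ⟨hi1, hi2⟩ := integrable_scaled (n := n) j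
  have hfin := norm_integral_le_of_norm_le (hi1.const_mul _) (Eventually.of_forall hbd)
  rw [integral_const_mul, hi2, ← e2, ← e1] at hfin
  rw [mul_right_comm, mul_comm, ← le_div_iff₀ (by positivity)]
  refine hfin.trans ?_
  rw [← hI]
  rw [le_div_iff₀ (by positivity)]
  calc _ = (1 + D) ^ M * C0 * I * A * 2 ^ (ν * N) := by field_simp
    _ ≤ _ := by gcongr; linarith

lemma atom_low {φ : ℕ → Sch n} (hφ : SmoothResolution n φ) (N M : ℕ) (D : ℝ)
    (hD : 0 ≤ D) :
    ∃ C : ℝ, 0 < C ∧ ∀ (j ν : ℕ), j ≤ ν → ∀ (a : Rn n → E) (c : Rn n) (A : ℝ),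
      0 ≤ A → Continuous a → (∀ x, ‖a x‖ ≤ A) →
      (∀ y, a y ≠ 0 → 2 ^ ν * ‖y - c‖ ≤ D) →
      (∀ k < N, ∀ r : Fin k → Fin n, ∫ y, (∏ l, (c - y) (r l)) • a y = 0) → ∀ x,
      (1 + 2 ^ j * ‖x - c‖) ^ M * ‖∫ y, invFourierS (φ j) (x - y) • a y‖ * 2 ^ (ν * (n + N))
        ≤ C * A * 2 ^ (j * (n + N)) := by
  obtain ⟨C0, hC0, hpsi⟩ := psi_bound hφ N M
  set V : ℝ := (volume (ball (0 : Rn n) 1)).toReal with hV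
  have hV0 : 0 ≤ V := ENNReal.toReal_nonneg
  refine ⟨(1 + D) ^ M * C0 * (D ^ (n + N) * V + 1), by positivity, ?_⟩
  intro j ν hjν a c A hA ha hda hs hm x
  set ψ := invFourierS (φ j) with hψ
  have hcs := compact_supp hs
  set z := x - c with hz
  let T : Rn n → ℂ := fun y => ∑ k ∈ Finset.range N, (k.factorial : ℝ)⁻¹ •
    iteratedFDeriv ℝ k ψ z (fun _ => c - y)
  have hterm : ∀ k ∈ Finset.range N, Integrable (fun y => ((k.factorial : ℝ)⁻¹ •
    iteratedFDeriv ℝ k ψ z (fun _ => c - y)) • a y) ∧ ∫ y, ((k.factorial : ℝ)⁻¹ •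
    iteratedFDeriv ℝ k ψ z (fun _ => c - y)) • a y = 0 := by
    intro k hk
    have hterm2 : ∀ r : Fin k → Fin n, Integrable (fun y : Rn n => (∏ l, (c - y) (r l)) • a y) := by
      intro r
      apply Continuous.integrable_of_hasCompactSupport
      · fun_prop
      · exact hcs.smul_left
    have e : (fun y : Rn n => ((k.factorial : ℝ)⁻¹ • iteratedFDeriv ℝ k ψ z (fun _ => c - y)) • a y)
      = fun y => ∑ r : Fin k → Fin n, ((k.factorial : ℝ)⁻¹ • iteratedFDeriv ℝ k ψ z (fun l => bv (r l)))
        • ((∏ l, (c - y) (r l)) • a y) := by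
      ext y
      rw [multilinear_expand, Finset.smul_sum, Finset.sum_smul]
      refine Finset.sum_congr rfl fun r _ => ?_
      rw [smul_comm _ (∏ l, (c - y) (r l)), smul_assoc, smul_comm]
    rw [e]
    constructor
    · exact integrable_finsetSum _ fun r _ => (hterm2 r).smul _
    · rw [integral_finsetSum]
      · refine Finset.sum_eq_zero fun r _ => ?_
        rw [integral_smul, hm k (Finset.mem_range.1 hk), smul_zero]
      · intro r _
        exact (hterm2 r).smul _
  have hTint : Integrable (fun y => T y • a y) := by
    simp only [T, Finset.sum_smul]
    exact integrable_finsetSum _ fun k hk => (hterm k hk).1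
  have hT0 : ∫ y, T y • a y = 0 := by
    simp only [T, Finset.sum_smul]
    rw [integral_finsetSum _ fun k hk => (hterm k hk).1]
    exact Finset.sum_eq_zero fun k hk => (hterm k hk).2
  have haint : Integrable (fun y => ψ (x - y) • a y) := by
    apply Continuous.integrable_of_hasCompactSupport
    · have := ψ.continuous
      fun_prop
    · exact hcs.smul_left
  have e2 : ∫ y, ψ (x - y) • a y = ∫ y, (ψ (x - y) - T y) • a y := by
    simp only [sub_smul]
    rw [integral_sub haint hTint, hT0, sub_zero]
  have hP : 0 < 1 + 2 ^ j * ‖z‖ := by positivity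
  have h2jν : (2:ℝ) ^ j ≤ 2 ^ ν := pow_le_pow_right₀ (by norm_num) hjν
  set W : ℝ := (1 + D) ^ M * C0 * 2 ^ (j * (n + N)) / (1 + 2 ^ j * ‖z‖) ^ M * (D / 2 ^ ν) ^ N with hW
  have hbd : ∀ y, ‖(ψ (x - y) - T y) • a y‖ ≤ W * A := by
    intro y
    by_cases hy : a y = 0
    · rw [hy, smul_zero, norm_zero]; positivity
    have hy' := hs y hy
    have hcy : ‖c - y‖ ≤ D / 2 ^ ν := by
      rw [le_div_iff₀ (by positivity), norm_sub_rev, mul_comm]; exact hy'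
    have hcy' : 2 ^ j * ‖c - y‖ ≤ D := by
      rw [norm_sub_rev]
      exact le_trans (by gcongr) hy'
    rw [norm_smul]
    refine mul_le_mul ?_ (hda y) (norm_nonneg _) (by positivity)
    have := taylor_bound (N := N) (ψ.smooth _) z (c - y)
      (B := (1 + D) ^ M * C0 * 2 ^ (j * (n + N)) / (1 + 2 ^ j * ‖z‖) ^ M) ?_
    · rw [show z + (c - y) = x - y by rw [hz]; abel] at this
      exact this.trans (by rw [hW]; gcongr)
    · intro t ht
      have h1 := hpsi j (z + t • (c - y))
      have h2 : ‖z‖ ≤ ‖z + t • (c - y)‖ + ‖c - y‖ := by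
        have : z = (z + t • (c - y)) - t • (c - y) := by abel
        conv_lhs => rw [this]
        refine (norm_sub_le _ _).trans ?_
        have h3 : ‖t • (c - y)‖ ≤ 1 * ‖c - y‖ := by
          rw [norm_smul, Real.norm_of_nonneg ht.1]
          gcongr
          exact ht.2
        simpa using h3
      have h4 : 2 ^ j * ‖z‖ ≤ 2 ^ j * ‖z + t • (c - y)‖ + 2 ^ j * ‖c - y‖ := by
        rw [← mul_add]; gcongr
      have h5 : 1 + 2 ^ j * ‖z‖ ≤ (1 + D) * (1 + 2 ^ j * ‖z + t • (c - y)‖) := by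
        have : 0 ≤ D * (2 ^ j * ‖z + t • (c - y)‖) := by positivity
        linarith
      rw [le_div_iff₀ (by positivity)]
      calc _ ≤ ‖iteratedFDeriv ℝ N ψ (z + t • (c - y))‖ * ((1 + D) * (1 + 2 ^ j * ‖z + t • (c - y)‖)) ^ M := by
            gcongr
        _ = (1 + D) ^ M * ((1 + 2 ^ j * ‖z + t • (c - y)‖) ^ M * ‖iteratedFDeriv ℝ N ψ (z + t • (c - y))‖) := by
            rw [mul_pow]; ring
        _ ≤ _ := by rw [mul_assoc]; gcongr
  have hset : ∫ y, (ψ (x - y) - T y) • a y = ∫ y in closedBall c (D / 2 ^ ν), (ψ (x - y) - T y) • a y := by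
    rw [setIntegral_eq_integral_of_forall_compl_eq_zero]
    intro y hy
    by_cases h : a y = 0
    · rw [h, smul_zero]
    · exfalso
      apply hy
      rw [mem_closedBall, dist_eq_norm, le_div_iff₀ (by positivity), mul_comm]
      exact hs y h
  have hvol : (volume : Measure (Rn n)).real (closedBall c (D / 2 ^ ν)) = (D / 2 ^ ν) ^ n * V := by
    rw [Measure.real, Measure.addHaar_closedBall _ _ (by positivity), finrank_euclideanSpace_fin,
      ENNReal.toReal_mul, ENNReal.toReal_ofReal (by positivity)]
  have hfin := norm_setIntegral_le_of_norm_le_const (μ := (volume : Measure (Rn n)))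
    (s := closedBall c (D / 2 ^ ν)) (measure_closedBall_lt_top) (fun y _ => hbd y)
  rw [← hset, ← e2, hvol] at hfin
  rw [mul_right_comm, mul_comm, ← le_div_iff₀ (by positivity)]
  refine hfin.trans ?_
  rw [le_div_iff₀ (by positivity), hW]
  calc _ = (1 + D) ^ M * C0 * (D ^ (n + N) * V) * A * 2 ^ (j * (n + N)) := by
        rw [div_pow, div_pow, ← pow_mul, ← pow_mul, pow_add D, mul_add ν, pow_add _ (ν * n)]
        field_simp
    _ ≤ _ := by gcongr; linarith

lemma moments {a : Rn n → E} (ha : Continuous a) (hcs : HasCompactSupport a) {L : ℤ}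
    (h : ∀ β : Fin n → ℕ, (mdeg β : ℤ) ≤ L → (∫ x : Rn n, (∏ i, (x i) ^ (β i)) • a x) = 0)
    {k : ℕ} (hk : (k : ℤ) ≤ L) (c : Rn n) (r : Fin k → Fin n) :
    ∫ y, (∏ l, (c - y) (r l)) • a y = 0 := by
  let P : MvPolynomial (Fin n) ℝ := ∏ l, (MvPolynomial.C (c (r l)) - MvPolynomial.X (r l))
  have hdeg : P.totalDegree ≤ k := by
    refine (MvPolynomial.totalDegree_finsetProd _ _).trans ?_
    calc _ ≤ ∑ l : Fin k, 1 := Finset.sum_le_sum fun l _ => by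
          refine (MvPolynomial.totalDegree_sub _ _).trans ?_
          simp
      _ = k := by simp
  have e : (fun y : Rn n => (∏ l, (c - y) (r l)) • a y) = fun y =>
      ∑ d ∈ P.support, P.coeff d • ((∏ i, y i ^ d i) • a y) := by
    ext y
    have : (∏ l, (c - y) (r l)) = MvPolynomial.eval (fun i => y i) P := by
      simp [P]
    rw [this, MvPolynomial.eval_eq', Finset.sum_smul]
    simp [smul_smul]
  rw [e, integral_finsetSum]
  · refine Finset.sum_eq_zero fun d hd => ?_
    rw [integral_smul, h, smul_zero]
    have h1 := MvPolynomial.le_totalDegree hd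
    have h2 : mdeg (fun i => d i) = d.sum fun _ e => e := by
      rw [mdeg, Finsupp.sum_fintype]; simp
    have h3 : mdeg (fun i => d i) ≤ k := by rw [h2]; exact h1.trans hdeg
    refine le_trans ?_ hk
    exact_mod_cast h3
  · intro d _
    apply Integrable.smul
    apply Continuous.integrable_of_hasCompactSupport
    · fun_prop
    · exact hcs.smul_left
end PartC

section PartD
variable {n : ℕ}

def latPt {n : ℕ} (ν : ℕ) (m : Fin n → ℤ) : Rn n := ((2:ℝ) ^ ν)⁻¹ • zpt m

def Bfac (n K N j ν : ℕ) : ℝ :=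
  if ν ≤ j then 2 ^ (-((j:ℝ) - ν) * K) else 2 ^ (-((ν:ℝ) - j) * (n + N))

lemma Bfac_pos (n K N j ν : ℕ) : 0 < Bfac n K N j ν := by
  unfold Bfac; split_ifs <;> positivity

lemma supp_dQ {d : ℝ} (hd : 1 < d) {ν : ℕ} {m : Fin n → ℤ} {y : Rn n} (hy : y ∈ dQ d ν m) :
    2 ^ ν * ‖y - latPt ν m‖ ≤ n * d := by
  have h1 : ‖y - latPt ν m‖ ≤ n * (d * (2 ^ ν)⁻¹) := by
    rw [EuclideanSpace.norm_eq]
    apply Real.sqrt_le_iff.2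
    refine ⟨by positivity, ?_⟩
    have h2 : ∀ i, ‖(y - latPt ν m) i‖ ^ 2 ≤ (d * (2 ^ ν)⁻¹) ^ 2 := by
      intro i
      have h := hy i
      rw [Real.rpow_neg (by norm_num), Real.rpow_natCast] at h
      have e : (y - latPt ν m) i = y i - (2 ^ ν)⁻¹ * (m i : ℝ) := by
        simp [latPt, zpt]
      rw [e, Real.norm_eq_abs]
      gcongr
      refine h.trans ?_
      have : 0 ≤ d * (2 ^ ν)⁻¹ := by positivity
      linarith
    calc _ ≤ ∑ i : Fin n, (d * (2 ^ ν)⁻¹) ^ 2 := Finset.sum_le_sum fun i _ => h2 i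
      _ = n * (d * (2 ^ ν)⁻¹) ^ 2 := by simp
      _ ≤ n ^ 2 * (d * (2 ^ ν)⁻¹) ^ 2 := by
        gcongr
        have : n ≤ n ^ 2 := Nat.le_self_pow (by norm_num) n
        exact_mod_cast this
      _ = _ := by ring
  calc _ ≤ 2 ^ ν * (n * (d * (2 ^ ν)⁻¹)) := by gcongr
    _ = _ := by field_simp

variable {E : Type*} [NormedAddCommGroup E] [NormedSpace ℂ E]

lemma mdeg_zero : mdeg (fun _ : Fin n => 0) = 0 := by simp [mdeg]

lemma mderiv_zero (g : Rn n → E) : mderiv (fun _ : Fin n => 0) g = g := by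
  unfold mderiv
  induction List.finRange n with
  | nil => rfl
  | cons i l ih => simp

lemma atom_bound [CompleteSpace E] {φ : ℕ → Sch n} (hφ : SmoothResolution n φ) (s : ℝ) (p : ℝ≥0∞)
    (K : ℕ) (L : ℤ) (hL : -1 ≤ L) (d : ℝ) (hd : 1 < d) (M : ℕ) :
    ∃ C : ℝ, 0 < C ∧ ∀ (j ν : ℕ) (m : Fin n → ℤ) (a : Rn n → E),
      (ν = 0 → Is1Atom K d m a) → (0 < ν → IsSPAtom s p K L d ν m a) → ∀ x,
      ‖∫ y, invFourierS (φ j) (x - y) • a y‖ ≤ C * 2 ^ (-(ν : ℝ) * (s - (n : ℝ) / p.toReal)) *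
        Bfac n K (L + 1).toNat j ν * ((1 + 2 ^ (min j ν) * ‖x - latPt ν m‖) ^ M)⁻¹ := by
  set N := (L + 1).toNat with hN
  have hD : 0 ≤ n * d := by positivity
  obtain ⟨C0, hC0, h0⟩ := atom_high (E := E) hφ 0 M (n * d) hD
  obtain ⟨C1, hC1, h1⟩ := atom_high (E := E) hφ K M (n * d) hD
  obtain ⟨C2, hC2, h2⟩ := atom_low (E := E) hφ N M (n * d) hD
  refine ⟨C0 + C1 * (n : ℝ) ^ K + C2, by positivity, ?_⟩
  intro j ν m a ha0 ha1 x
  set X : ℝ := 2 ^ (-(ν : ℝ) * (s - (n : ℝ) / p.toReal)) with hX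
  have hXp : 0 < X := by positivity
  have hcd : ContDiff ℝ K a := by
    rcases Nat.eq_zero_or_pos ν with h | h
    · exact (ha0 h).1
    · exact (ha1 h).1
  have hsupp : ∀ y, a y ≠ 0 → 2 ^ ν * ‖y - latPt ν m‖ ≤ n * d := by
    intro y hy
    apply supp_dQ hd
    rcases Nat.eq_zero_or_pos ν with h | h
    · subst h; exact (ha0 rfl).2.1 hy
    · exact (ha1 h).2.1 hy
  have hder : ∀ α : Fin n → ℕ, mdeg α ≤ K → ∀ x, ‖mderiv α a x‖ ≤ X * 2 ^ (ν * mdeg α) := by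
    intro α hα x
    rcases Nat.eq_zero_or_pos ν with h | h
    · have := (ha0 h).2.2 α hα x
      subst h
      simpa [hX] using this
    · refine ((ha1 h).2.2.1 α hα x).trans (le_of_eq ?_)
      rw [Real.rpow_add (by norm_num), hX]
      congr 1
      rw [← Real.rpow_natCast]
      push_cast
      ring_nf
  have hsup : ∀ x, ‖a x‖ ≤ X := by
    intro x
    have := hder (fun _ => 0) (by simp [mdeg_zero]) x
    simpa [mderiv_zero, mdeg_zero] using this
  have hP : ∀ k : ℕ, 0 < (1 + 2 ^ k * ‖x - latPt ν m‖) ^ M := fun k => by positivity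
  have hBp := Bfac_pos n K N j ν
  have key : ∃ C' : ℝ, 0 ≤ C' ∧ C' ≤ C0 + C1 * (n : ℝ) ^ K + C2 ∧
      ‖∫ y, invFourierS (φ j) (x - y) • a y‖ ≤ C' * X * Bfac n K N j ν *
      ((1 + 2 ^ (min j ν) * ‖x - latPt ν m‖) ^ M)⁻¹ := by
    by_cases hνj : ν ≤ j
    · rcases Nat.eq_zero_or_pos j with hj | hj
      · refine ⟨C0, hC0.le, by have : 0 ≤ C1 * (n : ℝ) ^ K := by positivity
                               linarith, ?_⟩
        have h := h0 j ν hνj (fun _ => rfl) a (latPt ν m) X hXp.le (hcd.of_le (by simp))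
          (by intro x; simpa using hsup x) hsupp x
        have hν : ν = 0 := by omega
        rw [← div_eq_mul_inv, le_div_iff₀ (hP _)]
        have hB : Bfac n K N j ν = 1 := by
          unfold Bfac; rw [if_pos hνj, hj, hν]; simp
        rw [hB, min_eq_right hνj, mul_comm]
        simpa using h
      · refine ⟨C1 * (n : ℝ) ^ K, by positivity, by linarith, ?_⟩
        have h := h1 j ν hνj (fun h => by omega) a (latPt ν m) ((n : ℝ) ^ K * X) (by positivity) hcd
          (by
            intro x
            rw [mul_assoc]
            have hb : 0 ≤ X * 2 ^ (ν * K) := by positivity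
            refine norm_iteratedFDeriv_le_mderiv hcd x hb fun α hα => ?_
            have := hder α hα.le x
            rwa [hα] at this) hsupp x
        rw [← div_eq_mul_inv, le_div_iff₀ (hP _)]
        have hB : Bfac n K N j ν = 2 ^ (ν * K) / 2 ^ (j * K) := by
          unfold Bfac; rw [if_pos hνj]
          rw [← Real.rpow_natCast, ← Real.rpow_natCast, ← Real.rpow_sub (by norm_num)]
          push_cast
          ring_nf
        rw [hB, min_eq_right hνj, ← mul_div_assoc, le_div_iff₀ (by positivity)]
        calc _ = _ := by rw [mul_comm ‖_‖]
          _ ≤ _ := h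
          _ = _ := by ring
    · have hjν : j < ν := not_le.1 hνj
      have hν : 0 < ν := by omega
      refine ⟨C2, hC2.le, by have : 0 ≤ C1 * (n : ℝ) ^ K := by positivity
                             linarith, ?_⟩
      have h := h2 j ν hjν.le a (latPt ν m) X hXp.le hcd.continuous hsup hsupp
        (fun k hk r => moments hcd.continuous (compact_supp hsupp) (ha1 hν).2.2.2 (by omega) _ r) x
      rw [← div_eq_mul_inv, le_div_iff₀ (hP _)]
      have hB : Bfac n K N j ν = 2 ^ (j * (n + N)) / 2 ^ (ν * (n + N)) := by
        unfold Bfac; rw [if_neg hνj]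
        rw [← Real.rpow_natCast, ← Real.rpow_natCast, ← Real.rpow_sub (by norm_num)]
        push_cast
        ring_nf
      rw [hB, min_eq_left hjν.le, ← mul_div_assoc, le_div_iff₀ (by positivity)]
      calc _ = _ := by rw [mul_comm ‖_‖]
        _ ≤ _ := h
  obtain ⟨C', hC', hC'le, hh⟩ := key
  have := hP (min j ν)
  exact hh.trans (by gcongr)
end PartD

section PartE1

lemma rpow_tsum_le {ι : Type*} (f : ι → ℝ≥0∞) {t : ℝ} (h0 : 0 < t) (h1 : t ≤ 1) :
    (∑' i, f i) ^ t ≤ ∑' i, f i ^ t := by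
  have hfin : ∀ S : Finset ι, (∑ i ∈ S, f i) ^ t ≤ ∑ i ∈ S, f i ^ t := by
    classical
    intro S
    induction S using Finset.induction_on with
    | empty => simp [h0]
    | insert i S hi ih =>
      rw [Finset.sum_insert hi, Finset.sum_insert hi]
      exact (ENNReal.rpow_add_le_add_rpow _ _ h0.le h1).trans (by gcongr)
  refine le_of_tendsto (((ENNReal.continuous_rpow_const (y := t)).tendsto _).comp
    ENNReal.summable.hasSum) (Eventually.of_forall fun S => ?_)
  exact (hfin S).trans (ENNReal.sum_le_tsum S)

lemma rpow_tsum_weight {ι : Type*} (w f : ι → ℝ≥0∞) {t : ℝ} (h1 : 1 ≤ t) :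
    (∑' i, w i * f i) ^ t ≤ (∑' i, w i) ^ (t - 1) * ∑' i, w i * f i ^ t := by
  have h0 : 0 < t := by linarith
  have hfin : ∀ S : Finset ι, ∑ i ∈ S, w i * f i ≤
      (∑' i, w i) ^ (1 - t⁻¹) * (∑' i, w i * f i ^ t) ^ t⁻¹ := by
    intro S
    refine (ENNReal.inner_le_weight_mul_Lp_of_nonneg S h1 w f).trans ?_
    have : 0 ≤ 1 - t⁻¹ := by
      have := inv_le_one_of_one_le₀ h1
      linarith
    exact mul_le_mul' (ENNReal.rpow_le_rpow (ENNReal.sum_le_tsum S) this)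
      (ENNReal.rpow_le_rpow (ENNReal.sum_le_tsum S) (by positivity))
  have h2 : ∑' i, w i * f i ≤ (∑' i, w i) ^ (1 - t⁻¹) * (∑' i, w i * f i ^ t) ^ t⁻¹ := by
    rw [ENNReal.tsum_eq_iSup_sum]
    exact iSup_le hfin
  calc _ ≤ ((∑' i, w i) ^ (1 - t⁻¹) * (∑' i, w i * f i ^ t) ^ t⁻¹) ^ t :=
        ENNReal.rpow_le_rpow h2 h0.le
    _ = _ := by
      rw [ENNReal.mul_rpow_of_nonneg _ _ h0.le, ← ENNReal.rpow_mul, ← ENNReal.rpow_mul,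
        inv_mul_cancel₀ h0.ne', ENNReal.rpow_one]
      congr 2
      field_simp

lemma kernel_sum {θ : ℝ} (hθ : 0 < θ) : ∃ S : ℝ≥0∞, S ≠ ∞ ∧
    (∀ j : ℕ, ∑' ν : ℕ, (2 : ℝ≥0∞) ^ (-θ * |(j : ℝ) - ν|) ≤ S) ∧
    (∀ ν : ℕ, ∑' j : ℕ, (2 : ℝ≥0∞) ^ (-θ * |(j : ℝ) - ν|) ≤ S) := by
  refine ⟨∑' z : ℤ, (2 : ℝ≥0∞) ^ (-θ * |(z : ℝ)|), ?_, ?_, ?_⟩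
  · have e : ∀ z : ℤ, (2 : ℝ≥0∞) ^ (-θ * |(z : ℝ)|) = ENNReal.ofReal (2 ^ (-θ * |(z : ℝ)|)) := by
      intro z
      rw [← ENNReal.ofReal_rpow_of_pos (by norm_num)]
      simp
    simp_rw [e]
    have hs : Summable fun k : ℕ => (2:ℝ) ^ (-θ * (k : ℝ)) := by
      simp_rw [Real.rpow_mul (show (0:ℝ) ≤ 2 by norm_num), Real.rpow_natCast]
      apply summable_geometric_of_lt_one (by positivity)
      apply Real.rpow_lt_one_of_one_lt_of_neg (by norm_num) (by linarith)
    have : Summable fun z : ℤ => (2:ℝ) ^ (-θ * |(z : ℝ)|) := by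
      rw [summable_int_iff_summable_nat_and_neg]
      simpa using hs
    exact this.tsum_ofReal_ne_top
  · intro j
    rw [← (Equiv.subLeft (j : ℤ)).tsum_eq (fun z : ℤ => (2 : ℝ≥0∞) ^ (-θ * |(z : ℝ)|))]
    have := ENNReal.tsum_comp_le_tsum_of_injective (f := fun ν : ℕ => (ν : ℤ)) Nat.cast_injective
      (fun z : ℤ => (2 : ℝ≥0∞) ^ (-θ * |(((Equiv.subLeft (j : ℤ)) z : ℤ) : ℝ)|))
    refine le_trans (le_of_eq ?_) this
    simp
  · intro j
    rw [← (Equiv.subLeft (j : ℤ)).tsum_eq (fun z : ℤ => (2 : ℝ≥0∞) ^ (-θ * |(z : ℝ)|))]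
    have := ENNReal.tsum_comp_le_tsum_of_injective (f := fun ν : ℕ => (ν : ℤ)) Nat.cast_injective
      (fun z : ℤ => (2 : ℝ≥0∞) ^ (-θ * |(((Equiv.subLeft (j : ℤ)) z : ℤ) : ℝ)|))
    refine le_trans (le_of_eq ?_) this
    simp [abs_sub_comm]

lemma discrete_young {t θ : ℝ} (ht : 0 < t) (hθ : 0 < θ) (q : ℝ≥0∞) (hq : 0 < q) (C : ℝ≥0∞)
    (hC : C ≠ ∞) : ∃ C' : ℝ≥0∞, C' ≠ ∞ ∧ ∀ A Λ : ℕ → ℝ≥0∞,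
      (∀ j, A j ^ t ≤ C * ∑' ν : ℕ, (2 : ℝ≥0∞) ^ (-θ * |(j : ℝ) - ν|) * Λ ν ^ t) →
      lqSum q A ≤ C' * lqSum q Λ := by
  obtain ⟨S, hS, hS1, hS2⟩ := kernel_sum hθ
  have ti : 0 < t⁻¹ := by positivity
  by_cases hqt : q = ∞
  · refine ⟨(C * S) ^ t⁻¹, ENNReal.rpow_ne_top_of_nonneg ti.le (ENNReal.mul_ne_top hC hS), ?_⟩
    intro A Λ h
    simp only [lqSum, if_pos hqt]
    refine iSup_le fun j => ?_
    have h1 : A j ^ t ≤ (C * S) * (⨆ ν, Λ ν) ^ t := by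
      refine (h j).trans ?_
      rw [mul_assoc]
      gcongr
      calc _ ≤ ∑' ν : ℕ, (2 : ℝ≥0∞) ^ (-θ * |(j : ℝ) - ν|) * (⨆ ν, Λ ν) ^ t := by
            gcongr with ν
            exact le_iSup Λ ν
        _ = (∑' ν : ℕ, (2 : ℝ≥0∞) ^ (-θ * |(j : ℝ) - ν|)) * (⨆ ν, Λ ν) ^ t := ENNReal.tsum_mul_right
        _ ≤ _ := by gcongr; exact hS1 j
    calc A j = (A j ^ t) ^ t⁻¹ := by rw [← ENNReal.rpow_mul, mul_inv_cancel₀ ht.ne', ENNReal.rpow_one]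
      _ ≤ ((C * S) * (⨆ ν, Λ ν) ^ t) ^ t⁻¹ := ENNReal.rpow_le_rpow h1 ti.le
      _ = _ := by
        rw [ENNReal.mul_rpow_of_nonneg _ _ ti.le, ← ENNReal.rpow_mul, mul_inv_cancel₀ ht.ne',
          ENNReal.rpow_one]
  · set u := q.toReal with hu
    have hu0 : 0 < u := ENNReal.toReal_pos hq.ne' hqt
    set r := u / t with hr
    have hr0 : 0 < r := by positivity
    have htr : t * r = u := by rw [hr]; field_simp
    have key : ∃ C1 : ℝ≥0∞, C1 ≠ ∞ ∧ ∀ A Λ : ℕ → ℝ≥0∞,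
      (∀ j, A j ^ t ≤ C * ∑' ν : ℕ, (2 : ℝ≥0∞) ^ (-θ * |(j : ℝ) - ν|) * Λ ν ^ t) →
      ∑' j, A j ^ u ≤ C1 * ∑' ν, Λ ν ^ u := by
      rcases le_total 1 r with h1r | hr1
      · refine ⟨C ^ r * S ^ (r - 1) * S, ENNReal.mul_ne_top (ENNReal.mul_ne_top
          (ENNReal.rpow_ne_top_of_nonneg hr0.le hC)
          (ENNReal.rpow_ne_top_of_nonneg (by linarith) hS)) hS, ?_⟩
        intro A Λ h
        have h1 : ∀ j, A j ^ u ≤ C ^ r * S ^ (r - 1) *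
            ∑' ν : ℕ, (2 : ℝ≥0∞) ^ (-θ * |(j : ℝ) - ν|) * Λ ν ^ u := by
          intro j
          calc A j ^ u = (A j ^ t) ^ r := by rw [← ENNReal.rpow_mul, htr]
            _ ≤ (C * ∑' ν : ℕ, (2 : ℝ≥0∞) ^ (-θ * |(j : ℝ) - ν|) * Λ ν ^ t) ^ r :=
              ENNReal.rpow_le_rpow (h j) hr0.le
            _ = C ^ r * (∑' ν : ℕ, (2 : ℝ≥0∞) ^ (-θ * |(j : ℝ) - ν|) * Λ ν ^ t) ^ r :=
              ENNReal.mul_rpow_of_nonneg _ _ hr0.le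
            _ ≤ C ^ r * ((∑' ν : ℕ, (2 : ℝ≥0∞) ^ (-θ * |(j : ℝ) - ν|)) ^ (r - 1) *
              ∑' ν : ℕ, (2 : ℝ≥0∞) ^ (-θ * |(j : ℝ) - ν|) * (Λ ν ^ t) ^ r) := by
                gcongr
                exact rpow_tsum_weight _ _ h1r
            _ ≤ C ^ r * (S ^ (r - 1) *
              ∑' ν : ℕ, (2 : ℝ≥0∞) ^ (-θ * |(j : ℝ) - ν|) * (Λ ν ^ t) ^ r) := by
                have h3 : 0 ≤ r - 1 := by linarith
                gcongr
                exact hS1 j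
            _ = _ := by
              simp_rw [← ENNReal.rpow_mul, htr]
              rw [mul_assoc]
        calc _ ≤ ∑' j : ℕ, C ^ r * S ^ (r - 1) *
            ∑' ν : ℕ, (2 : ℝ≥0∞) ^ (-θ * |(j : ℝ) - ν|) * Λ ν ^ u := ENNReal.tsum_le_tsum h1
          _ = C ^ r * S ^ (r - 1) *
            ∑' ν : ℕ, (∑' j : ℕ, (2 : ℝ≥0∞) ^ (-θ * |(j : ℝ) - ν|)) * Λ ν ^ u := by
              rw [ENNReal.tsum_mul_left, ENNReal.tsum_comm]
              simp_rw [ENNReal.tsum_mul_right]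
          _ ≤ C ^ r * S ^ (r - 1) * ∑' ν : ℕ, S * Λ ν ^ u := by
              gcongr with ν
              exact hS2 ν
          _ = _ := by rw [ENNReal.tsum_mul_left]; ring
      · obtain ⟨S', hS', hS1', hS2'⟩ := kernel_sum (θ := θ * r) (by positivity)
        refine ⟨C ^ r * S', ENNReal.mul_ne_top (ENNReal.rpow_ne_top_of_nonneg hr0.le hC) hS', ?_⟩
        intro A Λ h
        have h1 : ∀ j, A j ^ u ≤ C ^ r *
            ∑' ν : ℕ, (2 : ℝ≥0∞) ^ (-(θ * r) * |(j : ℝ) - ν|) * Λ ν ^ u := by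
          intro j
          calc A j ^ u = (A j ^ t) ^ r := by rw [← ENNReal.rpow_mul, htr]
            _ ≤ (C * ∑' ν : ℕ, (2 : ℝ≥0∞) ^ (-θ * |(j : ℝ) - ν|) * Λ ν ^ t) ^ r :=
              ENNReal.rpow_le_rpow (h j) hr0.le
            _ = C ^ r * (∑' ν : ℕ, (2 : ℝ≥0∞) ^ (-θ * |(j : ℝ) - ν|) * Λ ν ^ t) ^ r :=
              ENNReal.mul_rpow_of_nonneg _ _ hr0.le
            _ ≤ C ^ r * (∑' ν : ℕ, ((2 : ℝ≥0∞) ^ (-θ * |(j : ℝ) - ν|) * (Λ ν ^ t)) ^ r) := by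
                gcongr
                exact rpow_tsum_le _ hr0 hr1
            _ = _ := by
              simp_rw [ENNReal.mul_rpow_of_nonneg _ _ hr0.le, ← ENNReal.rpow_mul, htr]
              congr 2
              ext ν
              congr 2
              ring
        calc _ ≤ ∑' j : ℕ, C ^ r *
            ∑' ν : ℕ, (2 : ℝ≥0∞) ^ (-(θ * r) * |(j : ℝ) - ν|) * Λ ν ^ u := ENNReal.tsum_le_tsum h1
          _ = C ^ r *
            ∑' ν : ℕ, (∑' j : ℕ, (2 : ℝ≥0∞) ^ (-(θ * r) * |(j : ℝ) - ν|)) * Λ ν ^ u := by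
              rw [ENNReal.tsum_mul_left, ENNReal.tsum_comm]
              simp_rw [ENNReal.tsum_mul_right]
          _ ≤ C ^ r * ∑' ν : ℕ, S' * Λ ν ^ u := by
              gcongr with ν
              exact hS2' ν
          _ = _ := by rw [ENNReal.tsum_mul_left]; ring
    obtain ⟨C1, hC1, hk⟩ := key
    have hu1 : 0 ≤ 1 / u := by positivity
    refine ⟨C1 ^ (1 / u), ENNReal.rpow_ne_top_of_nonneg hu1 hC1, ?_⟩
    intro A Λ h
    simp only [lqSum, if_neg hqt]
    rw [← ENNReal.mul_rpow_of_nonneg _ _ hu1]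
    exact ENNReal.rpow_le_rpow (hk A Λ h) hu1

end PartE1

section PartE2
variable {n : ℕ}

/-- scaled decay weight -/
def wt (τ r : ℝ) (z : Rn n) : ℝ≥0∞ := ENNReal.ofReal ((1 + τ * ‖z‖) ^ (-r))

lemma measurable_wt (τ r : ℝ) : Measurable (wt (n := n) τ r) := by
  unfold wt; fun_prop

lemma wt_rpow {τ : ℝ} (hτ : 0 < τ) (r t : ℝ) (ht : 0 ≤ t) (z : Rn n) :
    wt τ r z ^ t = wt τ (r * t) z := by
  unfold wt
  rw [ENNReal.ofReal_rpow_of_nonneg (by positivity) ht, ← Real.rpow_mul (by positivity), neg_mul]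

lemma lintegral_scale {τ : ℝ} (hτ : 0 < τ) (g : Rn n → ℝ≥0∞) (hg : Measurable g) :
    ∫⁻ y, g (τ • y) = ENNReal.ofReal (τ ^ n)⁻¹ * ∫⁻ y, g y := by
  have h := lintegral_map (μ := (volume : Measure (Rn n))) hg (measurable_const_smul τ)
  rw [← h, Measure.map_addHaar_smul _ hτ.ne', lintegral_smul_measure, finrank_euclideanSpace_fin,
    abs_of_pos (by positivity), smul_eq_mul]

lemma lintegral_wt {r : ℝ} (hr : (n : ℝ) < r) : ∃ I : ℝ≥0∞, I ≠ ∞ ∧ ∀ τ : ℝ, 0 < τ → ∀ c : Rn n,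
    ∫⁻ y, wt τ r (y - c) = ENNReal.ofReal (τ ^ n)⁻¹ * I := by
  refine ⟨∫⁻ y : Rn n, wt 1 r y, ?_, ?_⟩
  · have := finite_integral_one_add_norm (E := Rn n) (μ := volume) (r := r) (by simpa using hr)
    simpa [wt] using this.ne
  · intro τ hτ c
    rw [lintegral_sub_right_eq_self (fun y => wt τ r y) c,
      ← lintegral_scale hτ _ (measurable_wt 1 r)]
    congr 1
    ext y
    simp [wt, norm_smul, abs_of_pos hτ]

lemma zpt_dist {m m' : Fin n → ℤ} (h : m ≠ m') : 1 ≤ ‖zpt m - zpt m'‖ := by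
  obtain ⟨i, hi⟩ := Function.ne_iff.1 h
  refine le_trans ?_ (PiLp.norm_apply_le (zpt m - zpt m') i)
  have : (zpt m - zpt m') i = ((m i - m' i : ℤ) : ℝ) := by simp [zpt]
  rw [this, Real.norm_eq_abs, ← Int.cast_abs]
  exact_mod_cast Int.one_le_abs (sub_ne_zero.2 hi)

lemma lattice_sum {r : ℝ} (hr : (n : ℝ) < r) : ∃ S : ℝ≥0∞, S ≠ ∞ ∧
    ∀ (μ ν : ℕ), μ ≤ ν → ∀ x : Rn n,
    ∑' m : Fin n → ℤ, wt (2 ^ μ) r (x - latPt ν m) ≤ S * 2 ^ (((ν : ℝ) - μ) * n) := by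
  obtain ⟨I, hI, hint⟩ := lintegral_wt hr
  have hr0 : 0 < r := lt_of_le_of_lt (Nat.cast_nonneg n) hr
  set V := (volume : Measure (Rn n)) (ball 0 (1/2)) with hV
  have hV0 : V ≠ 0 := (measure_ball_pos volume _ (by norm_num)).ne'
  have hVt : V ≠ ∞ := measure_ball_lt_top.ne
  refine ⟨V⁻¹ * (ENNReal.ofReal (2 ^ r) * I), ENNReal.mul_ne_top (ENNReal.inv_ne_top.2 hV0)
    (ENNReal.mul_ne_top ENNReal.ofReal_ne_top hI), ?_⟩
  intro μ ν hμν x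
  set τ : ℝ := 2 ^ μ / 2 ^ ν with hτ
  have hτ0 : 0 < τ := by positivity
  have hτ1 : τ ≤ 1 := by
    rw [hτ, div_le_one (by positivity)]
    exact pow_le_pow_right₀ (by norm_num) hμν
  set u : Rn n := (2:ℝ) ^ ν • x with hu
  have e1 : ∀ m : Fin n → ℤ, wt (2 ^ μ) r (x - latPt ν m) = wt τ r (u - zpt m) := by
    intro m
    have : u - zpt m = (2:ℝ) ^ ν • (x - latPt ν m) := by
      rw [smul_sub, hu, latPt, smul_smul, mul_inv_cancel₀ (by positivity), one_smul]
    rw [this, wt, wt, norm_smul, Real.norm_of_nonneg (by positivity), hτ]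
    congr 3
    field_simp
  have e2 : ∀ m : Fin n → ℤ, wt τ r (u - zpt m) * V ≤
      ∫⁻ y in ball (zpt m) (1/2), ENNReal.ofReal (2 ^ r) * wt τ r (y - u) := by
    intro m
    have hvol : volume (ball (zpt m : Rn n) (1/2)) = V := Measure.addHaar_ball_center _ _ _
    rw [← hvol, ← setLIntegral_const]
    refine setLIntegral_mono ((measurable_wt τ r).comp (measurable_id.sub_const u) |>.const_mul _) ?_
    intro y hy
    rw [mem_ball, dist_eq_norm] at hy
    unfold wt
    rw [← ENNReal.ofReal_mul (by positivity)]
    apply ENNReal.ofReal_le_ofReal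
    have h1 : ‖y - u‖ ≤ 1 / 2 + ‖u - zpt m‖ := by
      have : y - u = (y - zpt m) - (u - zpt m) := by abel
      rw [this]
      exact (norm_sub_le _ _).trans (by linarith)
    have h2 : 1 + τ * ‖y - u‖ ≤ 2 * (1 + τ * ‖u - zpt m‖) := by
      have h3 : τ * ‖y - u‖ ≤ τ * (1 / 2 + ‖u - zpt m‖) := by gcongr
      have h4 : 0 ≤ τ * ‖u - zpt m‖ := by positivity
      linarith
    rw [Real.rpow_neg (by positivity), Real.rpow_neg (by positivity), ← div_eq_mul_inv,
      le_div_iff₀ (by positivity), inv_mul_le_iff₀ (by positivity),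
      ← Real.mul_rpow (by positivity) (by norm_num)]
    exact Real.rpow_le_rpow (by positivity) (by linarith) hr0.le
  have hdisj : Pairwise (Function.onFun Disjoint fun m : Fin n → ℤ => ball (zpt m : Rn n) (1/2)) := by
    intro m m' hmm
    apply ball_disjoint_ball
    rw [dist_eq_norm]
    have := zpt_dist hmm
    linarith
  have e3 : (∑' m : Fin n → ℤ, wt τ r (u - zpt m)) * V ≤
      ENNReal.ofReal (2 ^ r) * (ENNReal.ofReal (τ ^ n)⁻¹ * I) := by
    rw [← ENNReal.tsum_mul_right]
    calc _ ≤ ∑' m : Fin n → ℤ, ∫⁻ y in ball (zpt m) (1/2), ENNReal.ofReal (2 ^ r) * wt τ r (y - u) :=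
          ENNReal.tsum_le_tsum e2
      _ = ∫⁻ y in ⋃ m : Fin n → ℤ, ball (zpt m) (1/2), ENNReal.ofReal (2 ^ r) * wt τ r (y - u) :=
          (lintegral_iUnion (fun m => measurableSet_ball) hdisj _).symm
      _ ≤ ∫⁻ y, ENNReal.ofReal (2 ^ r) * wt τ r (y - u) := setLIntegral_le_lintegral _ _
      _ = _ := by
        have hme : Measurable fun y : Rn n => wt τ r (y - u) :=
          (measurable_wt τ r).comp (measurable_id.sub_const u)
        rw [lintegral_const_mul _ hme, hint τ hτ0]
  have e4 : ENNReal.ofReal (τ ^ n)⁻¹ = 2 ^ (((ν : ℝ) - μ) * n) := by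
    have : (τ ^ n)⁻¹ = 2 ^ (((ν : ℝ) - μ) * n) := by
      rw [Real.rpow_mul (by norm_num), Real.rpow_sub (by norm_num)]
      simp only [Real.rpow_natCast]
      rw [hτ, ← inv_pow, inv_div]
    rw [this, ← ENNReal.ofReal_rpow_of_pos (by norm_num)]
    simp
  simp_rw [e1]
  rw [e4] at e3
  calc _ = V⁻¹ * ((∑' m : Fin n → ℤ, wt τ r (u - zpt m)) * V) := by
        rw [mul_comm _ V, ← mul_assoc, ENNReal.inv_mul_cancel hV0 hVt, one_mul]
    _ ≤ V⁻¹ * (ENNReal.ofReal (2 ^ r) * (2 ^ (((ν : ℝ) - μ) * n) * I)) := by gcongr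
    _ = _ := by ring

end PartE2

section PartE3
variable {n : ℕ}

lemma abs_le1 {t : ℝ} (h0 : 0 < t) (h1 : t ≤ 1) (F : Rn n → ℝ≥0∞)
    (Λ : ℕ → (Fin n → ℤ) → ℝ≥0∞) (G I : ℕ → ℝ≥0∞) (w : ℕ → (Fin n → ℤ) → Rn n → ℝ≥0∞)
    (hw : ∀ ν m, Measurable (w ν m)) (hI : ∀ ν m, ∫⁻ x, w ν m x ^ t ≤ I ν)
    (hF : ∀ x, F x ≤ ∑' νm : ℕ × (Fin n → ℤ), Λ νm.1 νm.2 * G νm.1 * w νm.1 νm.2 x) :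
    ∫⁻ x, F x ^ t ≤ ∑' ν, G ν ^ t * I ν * ∑' m, Λ ν m ^ t := by
  calc _ ≤ ∫⁻ x, ∑' νm : ℕ × (Fin n → ℤ), (Λ νm.1 νm.2 * G νm.1) ^ t * w νm.1 νm.2 x ^ t := by
        refine lintegral_mono fun x => ?_
        refine (ENNReal.rpow_le_rpow (hF x) h0.le).trans ((rpow_tsum_le _ h0 h1).trans (le_of_eq ?_))
        simp_rw [ENNReal.mul_rpow_of_nonneg _ _ h0.le]
    _ = ∑' νm : ℕ × (Fin n → ℤ), (Λ νm.1 νm.2 * G νm.1) ^ t * ∫⁻ x, w νm.1 νm.2 x ^ t := by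
        rw [lintegral_tsum fun νm => (((hw _ _).pow_const t).const_mul _).aemeasurable]
        congr 1
        ext νm
        rw [lintegral_const_mul _ ((hw _ _).pow_const t)]
    _ ≤ ∑' νm : ℕ × (Fin n → ℤ), (Λ νm.1 νm.2 * G νm.1) ^ t * I νm.1 := by
        gcongr with νm
        exact hI _ _
    _ = ∑' ν, ∑' m, (Λ ν m * G ν) ^ t * I ν :=
        ENNReal.tsum_prod (f := fun ν m => (Λ ν m * G ν) ^ t * I ν)
    _ = _ := by
        congr 1
        ext ν
        rw [← ENNReal.tsum_mul_left]
        congr 1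
        ext m
        rw [ENNReal.mul_rpow_of_nonneg _ _ h0.le]
        ring

lemma abs_ge1 {t : ℝ} (h1 : 1 ≤ t) (F : Rn n → ℝ≥0∞)
    (Λ : ℕ → (Fin n → ℤ) → ℝ≥0∞) (G I u : ℕ → ℝ≥0∞) (w : ℕ → (Fin n → ℤ) → Rn n → ℝ≥0∞)
    (S : ℝ≥0∞) (hu0 : ∀ ν, u ν ≠ 0) (hut : ∀ ν, u ν ≠ ∞)
    (hS : ∀ x, ∑' νm : ℕ × (Fin n → ℤ), u νm.1 * w νm.1 νm.2 x ≤ S)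
    (hw : ∀ ν m, Measurable (w ν m)) (hI : ∀ ν m, ∫⁻ x, w ν m x ≤ I ν)
    (hF : ∀ x, F x ≤ ∑' νm : ℕ × (Fin n → ℤ), Λ νm.1 νm.2 * G νm.1 * w νm.1 νm.2 x) :
    ∫⁻ x, F x ^ t ≤ S ^ (t - 1) * ∑' ν, u ν * (u ν)⁻¹ ^ t * G ν ^ t * I ν * ∑' m, Λ ν m ^ t := by
  have h0 : 0 < t := by linarith
  have h10 : 0 ≤ t - 1 := by linarith
  calc _ ≤ ∫⁻ x, S ^ (t - 1) * ∑' νm : ℕ × (Fin n → ℤ),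
        (u νm.1 * ((u νm.1)⁻¹ * Λ νm.1 νm.2 * G νm.1) ^ t) * w νm.1 νm.2 x := by
        refine lintegral_mono fun x => ?_
        have h2 : F x ≤ ∑' νm : ℕ × (Fin n → ℤ), (u νm.1 * w νm.1 νm.2 x) *
            ((u νm.1)⁻¹ * Λ νm.1 νm.2 * G νm.1) := by
          refine (hF x).trans (le_of_eq ?_)
          congr 1
          ext νm
          calc _ = (u νm.1 * (u νm.1)⁻¹) * (Λ νm.1 νm.2 * G νm.1 * w νm.1 νm.2 x) := by
                rw [ENNReal.mul_inv_cancel (hu0 _) (hut _), one_mul]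
            _ = _ := by ring
        refine (ENNReal.rpow_le_rpow h2 h0.le).trans ((rpow_tsum_weight _ _ h1).trans ?_)
        refine mul_le_mul' (ENNReal.rpow_le_rpow (hS x) h10) (le_of_eq ?_)
        congr 1
        ext νm
        ring
    _ = S ^ (t - 1) * ∑' νm : ℕ × (Fin n → ℤ),
        (u νm.1 * ((u νm.1)⁻¹ * Λ νm.1 νm.2 * G νm.1) ^ t) * ∫⁻ x, w νm.1 νm.2 x := by
        rw [lintegral_const_mul, lintegral_tsum fun νm => ((hw _ _).const_mul _).aemeasurable]
        · congr 2
          ext νm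
          rw [lintegral_const_mul _ (hw _ _)]
        · exact Measurable.ennreal_tsum fun νm => (hw _ _).const_mul _
    _ ≤ S ^ (t - 1) * ∑' νm : ℕ × (Fin n → ℤ),
        (u νm.1 * ((u νm.1)⁻¹ * Λ νm.1 νm.2 * G νm.1) ^ t) * I νm.1 := by
        gcongr with νm
        exact hI _ _
    _ = S ^ (t - 1) * ∑' ν, ∑' m, (u ν * ((u ν)⁻¹ * Λ ν m * G ν) ^ t) * I ν := by
        rw [ENNReal.tsum_prod (f := fun ν m => (u ν * ((u ν)⁻¹ * Λ ν m * G ν) ^ t) * I ν)]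
    _ = _ := by
        congr 2
        ext ν
        rw [← ENNReal.tsum_mul_left]
        congr 1
        ext m
        rw [ENNReal.mul_rpow_of_nonneg _ _ h0.le, ENNReal.mul_rpow_of_nonneg _ _ h0.le]
        ring

/-- exponent of the gain factor -/
def Ge (s P : ℝ) (n K N j ν : ℕ) : ℝ :=
  -(ν : ℝ) * (s - P) + if ν ≤ j then -((j:ℝ) - ν) * K else -((ν:ℝ) - j) * (n + N)

lemma exp_le1 {s P δ t : ℝ} {n K N : ℕ} (ht : 0 < t) (hP : P * t = n) (h1 : δ ≤ K - s)
    (h2 : δ ≤ s + N - (P - n)) (j ν : ℕ) :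
    j * s * t + Ge s P n K N j ν * t + -((min j ν : ℕ) : ℝ) * n ≤ -(δ * t) * |(j : ℝ) - ν| := by
  unfold Ge
  rw [← hP] at *
  by_cases h : ν ≤ j
  · have h' : (ν : ℝ) ≤ j := by exact_mod_cast h
    rw [if_pos h, min_eq_right h, abs_of_nonneg (by linarith)]
    have := mul_nonneg (mul_nonneg ht.le (sub_nonneg.2 h1)) (sub_nonneg.2 h')
    nlinarith
  · have h' : (j : ℝ) ≤ ν := by exact_mod_cast (not_le.1 h).le
    rw [if_neg h, min_eq_left (not_le.1 h).le, abs_of_nonpos (by linarith)]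
    have := mul_nonneg (mul_nonneg ht.le (sub_nonneg.2 h2)) (sub_nonneg.2 h')
    nlinarith

lemma exp_ge1 {s P δ t : ℝ} {n K N : ℕ} (ht : 1 ≤ t) (hP : P * t = n) (hδ : 0 ≤ δ) (h1 : δ ≤ K - s)
    (h2 : δ ≤ s + N) (j ν : ℕ) :
    j * s * t + (-(δ / 2) * |(j : ℝ) - ν| - ((ν : ℝ) - (min j ν : ℕ)) * n)
      - (-(δ / 2) * |(j : ℝ) - ν| - ((ν : ℝ) - (min j ν : ℕ)) * n) * t
      + Ge s P n K N j ν * t + -((min j ν : ℕ) : ℝ) * n ≤ -(δ * t / 2) * |(j : ℝ) - ν| := by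
  unfold Ge
  rw [← hP]
  by_cases h : ν ≤ j
  · have h' : (ν : ℝ) ≤ j := by exact_mod_cast h
    rw [if_pos h, min_eq_right h, abs_of_nonneg (by linarith)]
    have := mul_nonneg (mul_nonneg (show 0 ≤ t by linarith) (sub_nonneg.2 h1)) (sub_nonneg.2 h')
    have := mul_nonneg hδ (sub_nonneg.2 h')
    nlinarith
  · have h' : (j : ℝ) ≤ ν := by exact_mod_cast (not_le.1 h).le
    rw [if_neg h, min_eq_left (not_le.1 h).le, abs_of_nonpos (by linarith)]
    have := mul_nonneg (mul_nonneg (show 0 ≤ t by linarith) (sub_nonneg.2 h2)) (sub_nonneg.2 h')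
    have := mul_nonneg hδ (sub_nonneg.2 h')
    nlinarith

lemma exp_top {s δ : ℝ} {n K N : ℕ} (h1 : δ ≤ K - s)
    (h2 : δ ≤ s + N) (j ν : ℕ) :
    j * s + Ge s 0 n K N j ν + ((ν : ℝ) - (min j ν : ℕ)) * n ≤ -δ * |(j : ℝ) - ν| := by
  unfold Ge
  by_cases h : ν ≤ j
  · have h' : (ν : ℝ) ≤ j := by exact_mod_cast h
    rw [if_pos h, min_eq_right h, abs_of_nonneg (by linarith)]
    have := mul_nonneg (sub_nonneg.2 h1) (sub_nonneg.2 h')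
    nlinarith
  · have h' : (j : ℝ) ≤ ν := by exact_mod_cast (not_le.1 h).le
    rw [if_neg h, min_eq_left (not_le.1 h).le, abs_of_nonpos (by linarith)]
    have := mul_nonneg (sub_nonneg.2 h2) (sub_nonneg.2 h')
    nlinarith

end PartE3

section PartE4
variable {n : ℕ}

lemma two_rpow_add (x y : ℝ) : (2:ℝ≥0∞) ^ x * 2 ^ y = 2 ^ (x + y) :=
  (ENNReal.rpow_add x y (by norm_num) (by norm_num)).symm

lemma lintegral_wt_two {r : ℝ} (hr : (n : ℝ) < r) : ∃ I : ℝ≥0∞, I ≠ ∞ ∧ ∀ (k : ℕ) (c : Rn n),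
    ∫⁻ y, wt (2 ^ k) r (y - c) = I * 2 ^ (-(k : ℝ) * n) := by
  obtain ⟨I, hI, h⟩ := lintegral_wt hr
  refine ⟨I, hI, fun k c => ?_⟩
  rw [h _ (by positivity), mul_comm]
  congr 1
  have : (((2:ℝ) ^ k) ^ n)⁻¹ = 2 ^ (-(k : ℝ) * n) := by
    rw [Real.rpow_mul (by norm_num), Real.rpow_neg (by norm_num)]
    simp only [Real.rpow_natCast]
    rw [inv_pow]
  rw [this, ← ENNReal.ofReal_rpow_of_pos (by norm_num)]
  simp

def lamNorm {n : ℕ} (p : ℝ≥0∞) (Λ : (Fin n → ℤ) → ℝ≥0∞) : ℝ≥0∞ :=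
  if p = ∞ then ⨆ m, Λ m else (∑' m, Λ m ^ p.toReal) ^ (1 / p.toReal)

lemma est_F {E : Type*} [NormedAddCommGroup E] (s δ : ℝ) (p : ℝ≥0∞) (hp : 0 < p) (K N M : ℕ)
    (hδ : 0 < δ) (h1 : δ ≤ K - s) (h2 : δ ≤ s + N - sigmaP n p) (hM : n < M)
    (hM' : p ≠ ∞ → (n : ℝ) < M * p.toReal) (C0 : ℝ≥0∞) (hC0 : C0 ≠ ∞) :
    ∃ (C : ℝ≥0∞) (t θ : ℝ), C ≠ ∞ ∧ 0 < t ∧ 0 < θ ∧ ∀ (j : ℕ) (g : Rn n → E)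
      (Λ : ℕ → (Fin n → ℤ) → ℝ≥0∞),
      (∀ x, ‖g x‖ₑ ≤ ∑' νm : ℕ × (Fin n → ℤ), Λ νm.1 νm.2 *
        (C0 * 2 ^ (Ge s (n / p.toReal) n K N j νm.1)) *
          wt (2 ^ (min j νm.1)) M (x - latPt νm.1 νm.2)) →
      ((2 : ℝ≥0∞) ^ ((j : ℝ) * s) * eLpNorm g p volume) ^ t ≤
        C * ∑' ν : ℕ, (2 : ℝ≥0∞) ^ (-θ * |(j : ℝ) - ν|) * lamNorm p (Λ ν) ^ t := by
  have hMr : (n : ℝ) < (M : ℝ) := by exact_mod_cast hM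
  obtain ⟨S0, hS0, hlat⟩ := lattice_sum hMr
  have hwm : ∀ j ν (m : Fin n → ℤ), Measurable fun x : Rn n => wt (2 ^ (min j ν)) M (x - latPt ν m) :=
    fun j ν m => (measurable_wt _ _).comp (measurable_id.sub_const _)
  have hσ1 : (n : ℝ) * (1 / p.toReal - 1) ≤ sigmaP n p := le_max_left _ _
  have hσ0 : 0 ≤ sigmaP n p := le_max_right _ _
  by_cases hpt : p = ∞
  · refine ⟨C0 * S0, 1, δ, ENNReal.mul_ne_top hC0 hS0, one_pos, hδ, ?_⟩
    intro j g Λ hg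
    simp only [ENNReal.rpow_one, lamNorm, if_pos hpt]
    have e0 : (n : ℝ) / p.toReal = 0 := by rw [hpt]; simp
    rw [e0] at hg
    have h3 : eLpNorm g p volume ≤ ∑' ν : ℕ, (⨆ m, Λ ν m) * (C0 * 2 ^ (Ge s 0 n K N j ν)) *
        (S0 * 2 ^ (((ν : ℝ) - (min j ν : ℕ)) * n)) := by
      rw [hpt, eLpNorm_exponent_top]
      refine essSup_le_of_ae_le _ (Eventually.of_forall fun x => ?_)
      refine (hg x).trans ?_
      rw [ENNReal.tsum_prod (f := fun ν m => Λ ν m *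
        (C0 * 2 ^ (Ge s 0 n K N j ν)) * wt (2 ^ (min j ν)) M (x - latPt ν m))]
      refine ENNReal.tsum_le_tsum fun ν => ?_
      calc _ ≤ ∑' m, (⨆ m, Λ ν m) * (C0 * 2 ^ (Ge s 0 n K N j ν)) *
              wt (2 ^ (min j ν)) M (x - latPt ν m) := by
            gcongr with m
            exact le_iSup (Λ ν) m
        _ = (⨆ m, Λ ν m) * (C0 * 2 ^ (Ge s 0 n K N j ν)) *
              ∑' m, wt (2 ^ (min j ν)) M (x - latPt ν m) := ENNReal.tsum_mul_left
        _ ≤ _ := by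
          gcongr
          exact hlat _ _ (min_le_right _ _) x
    calc _ ≤ (2 : ℝ≥0∞) ^ ((j : ℝ) * s) * ∑' ν : ℕ, (⨆ m, Λ ν m) * (C0 * 2 ^ (Ge s 0 n K N j ν)) *
        (S0 * 2 ^ (((ν : ℝ) - (min j ν : ℕ)) * n)) := by gcongr
      _ ≤ _ := by
        rw [← ENNReal.tsum_mul_left, ← ENNReal.tsum_mul_left]
        refine ENNReal.tsum_le_tsum fun ν => ?_
        calc _ = C0 * S0 * (((2 : ℝ≥0∞) ^ ((j : ℝ) * s) * 2 ^ (Ge s 0 n K N j ν) *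
            2 ^ (((ν : ℝ) - (min j ν : ℕ)) * n)) * ⨆ m, Λ ν m) := by ring
          _ ≤ _ := by
            rw [two_rpow_add, two_rpow_add]
            gcongr
            · norm_num
            · exact exp_top h1 (by linarith) j ν
  · set t := p.toReal with ht
    have ht0 : 0 < t := ENNReal.toReal_pos hp.ne' hpt
    have hP : (n : ℝ) / t * t = n := by field_simp
    have hnorm : ∀ (j : ℕ) (g : Rn n → E), ((2 : ℝ≥0∞) ^ ((j : ℝ) * s) * eLpNorm g p volume) ^ t
        = 2 ^ ((j : ℝ) * s * t) * ∫⁻ x, ‖g x‖ₑ ^ t := by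
      intro j g
      rw [eLpNorm_eq_lintegral_rpow_enorm_toReal hp.ne' hpt, ENNReal.mul_rpow_of_nonneg _ _ ht0.le,
        ← ENNReal.rpow_mul, ← ENNReal.rpow_mul, one_div, inv_mul_cancel₀ ht0.ne', ENNReal.rpow_one]
    have hlam : ∀ Λ : (Fin n → ℤ) → ℝ≥0∞, lamNorm p Λ ^ t = ∑' m, Λ m ^ t := by
      intro Λ
      rw [lamNorm, if_neg hpt, ← ENNReal.rpow_mul, one_div, inv_mul_cancel₀ ht0.ne', ENNReal.rpow_one]
    rcases le_total t 1 with ht1 | ht1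
    · obtain ⟨I, hI, hint⟩ := lintegral_wt_two (n := n) (hM' hpt)
      refine ⟨C0 ^ t * I, t, δ * t, ENNReal.mul_ne_top (ENNReal.rpow_ne_top_of_nonneg ht0.le hC0) hI,
        ht0, by positivity, ?_⟩
      intro j g Λ hg
      rw [hnorm]
      simp_rw [hlam]
      have h3 := abs_le1 ht0 ht1 _ Λ (fun ν => C0 * 2 ^ (Ge s (n / t) n K N j ν))
        (fun ν => I * 2 ^ (-((min j ν : ℕ) : ℝ) * n))
        (fun ν m x => wt (2 ^ (min j ν)) M (x - latPt ν m)) (hwm j) (by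
          intro ν m
          simp_rw [wt_rpow (show (0:ℝ) < 2 ^ (min j ν) by positivity) _ _ ht0.le]
          exact (hint _ _).le) hg
      refine (mul_le_mul_right h3 _).trans ?_
      rw [← ENNReal.tsum_mul_left, ← ENNReal.tsum_mul_left]
      refine ENNReal.tsum_le_tsum fun ν => ?_
      rw [ENNReal.mul_rpow_of_nonneg _ _ ht0.le, ← ENNReal.rpow_mul]
      calc _ = C0 ^ t * I * (((2 : ℝ≥0∞) ^ ((j : ℝ) * s * t) * 2 ^ (Ge s (n / t) n K N j ν * t) *
            2 ^ (-((min j ν : ℕ) : ℝ) * n)) * ∑' m, Λ ν m ^ t) := by ring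
        _ ≤ _ := by
          rw [two_rpow_add, two_rpow_add]
          gcongr
          · norm_num
          · refine exp_le1 ht0 hP h1 ?_ j ν
            have : (n : ℝ) * (1 / t - 1) = n / t - n := by ring
            linarith
    · obtain ⟨I, hI, hint⟩ := lintegral_wt_two (n := n) hMr
      obtain ⟨S1, hS1, hk, -⟩ := kernel_sum (θ := δ / 2) (by positivity)
      have ht10 : 0 ≤ t - 1 := by linarith
      refine ⟨(S0 * S1) ^ (t - 1) * (C0 ^ t * I), t, δ * t / 2, ENNReal.mul_ne_top
        (ENNReal.rpow_ne_top_of_nonneg ht10 (ENNReal.mul_ne_top hS0 hS1))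
        (ENNReal.mul_ne_top (ENNReal.rpow_ne_top_of_nonneg ht0.le hC0) hI),
        ht0, by positivity, ?_⟩
      intro j g Λ hg
      rw [hnorm]
      simp_rw [hlam]
      let e : ℕ → ℝ := fun ν => -(δ / 2) * |(j : ℝ) - ν| - ((ν : ℝ) - (min j ν : ℕ)) * n
      have h3 := abs_ge1 ht1 _ Λ (fun ν => C0 * 2 ^ (Ge s (n / t) n K N j ν))
        (fun ν => I * 2 ^ (-((min j ν : ℕ) : ℝ) * n)) (fun ν => 2 ^ (e ν))
        (fun ν m x => wt (2 ^ (min j ν)) M (x - latPt ν m)) (S0 * S1)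
        (fun ν => (ENNReal.rpow_pos (by norm_num) (by norm_num)).ne')
        (fun ν => ENNReal.rpow_ne_top_of_ne_zero (by norm_num) (by norm_num)) (by
          intro x
          rw [ENNReal.tsum_prod (f := fun ν m => (2:ℝ≥0∞) ^ (e ν) *
            wt (2 ^ (min j ν)) M (x - latPt ν m))]
          calc _ ≤ ∑' ν : ℕ, S0 * (2:ℝ≥0∞) ^ (-(δ / 2) * |(j : ℝ) - ν|) := by
                refine ENNReal.tsum_le_tsum fun ν => ?_
                rw [ENNReal.tsum_mul_left]
                refine (mul_le_mul_right (hlat _ _ (min_le_right j ν) x) _).trans (le_of_eq ?_)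
                calc _ = S0 * ((2:ℝ≥0∞) ^ (e ν) * 2 ^ (((ν : ℝ) - (min j ν : ℕ)) * n)) := by ring
                  _ = _ := by rw [two_rpow_add]; simp only [e, sub_add_cancel]
            _ = S0 * ∑' ν : ℕ, (2:ℝ≥0∞) ^ (-(δ / 2) * |(j : ℝ) - ν|) := ENNReal.tsum_mul_left
            _ ≤ _ := by gcongr; exact hk j) (hwm j) (fun ν m => (hint _ _).le) hg
      refine (mul_le_mul_right h3 _).trans ?_
      rw [mul_left_comm, mul_assoc ((S0 * S1) ^ (t - 1)) (C0 ^ t * I)]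
      refine mul_le_mul_right ?_ _
      rw [← ENNReal.tsum_mul_left, ← ENNReal.tsum_mul_left]
      refine ENNReal.tsum_le_tsum fun ν => ?_
      rw [ENNReal.mul_rpow_of_nonneg _ _ ht0.le, ← ENNReal.rpow_mul, ← ENNReal.rpow_neg,
        ← ENNReal.rpow_mul]
      calc _ = C0 ^ t * I * (((2 : ℝ≥0∞) ^ ((j : ℝ) * s * t) * 2 ^ (e ν) * 2 ^ (-e ν * t) *
            2 ^ (Ge s (n / t) n K N j ν * t) *
            2 ^ (-((min j ν : ℕ) : ℝ) * n)) * ∑' m, Λ ν m ^ t) := by ring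
        _ ≤ _ := by
          rw [two_rpow_add, two_rpow_add, two_rpow_add, two_rpow_add]
          gcongr
          · norm_num
          · refine le_trans (le_of_eq ?_) (exp_ge1 (N := N) ht1 hP hδ.le h1 (by linarith) j ν)
            simp only [e]
            ring
end PartE4

section PartF
variable {n : ℕ} {E : Type*} [NormedAddCommGroup E] [NormedSpace ℂ E]

lemma shiftReflect_apply (ψ : Sch n) (x y : Rn n) : shiftReflect ψ x y = ψ (x - y) := rfl

lemma pointwise [CompleteSpace E] {φ : ℕ → Sch n} (hφ : SmoothResolution n φ) (s : ℝ) (p : ℝ≥0∞)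
    (K : ℕ) (L : ℤ) (hL : -1 ≤ L) (d : ℝ) (hd : 1 < d) (M : ℕ) :
    ∃ C0 : ℝ≥0∞, C0 ≠ ∞ ∧ ∀ (f : TDist n E) (lam : ℕ → (Fin n → ℤ) → ℂ)
        (a : ℕ → (Fin n → ℤ) → Rn n → E),
      (∀ m, Is1Atom K d m (a 0 m)) →
      (∀ ν m, 0 < ν → IsSPAtom s p K L d ν m (a ν m)) →
      RepresentsAtomic f lam a → ∀ j x,
      ‖mOp (φ j) f x‖ₑ ≤ ∑' νm : ℕ × (Fin n → ℤ), (‖lam νm.1 νm.2‖₊ : ℝ≥0∞) *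
        (C0 * 2 ^ (Ge s (n / p.toReal) n K (L + 1).toNat j νm.1)) *
          wt (2 ^ (min j νm.1)) M (x - latPt νm.1 νm.2) := by
  obtain ⟨C, hC, hb⟩ := atom_bound (E := E) hφ s p K L hL d hd M
  set κ : ℝ := (2 * π) ^ (-(n : ℝ) / 2) with hκ
  refine ⟨‖κ‖ₑ * ENNReal.ofReal C, ENNReal.mul_ne_top enorm_ne_top ENNReal.ofReal_ne_top, ?_⟩
  intro f lam a ha0 ha1 hrep j x
  have h1 := hrep (shiftReflect (invFourierS (φ j)) x)
  simp only [mOp, tdConv]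
  rw [enorm_smul, ← h1.tsum_eq]
  refine (mul_le_mul_right enorm_tsum_le_tsum_enorm _).trans ?_
  rw [← ENNReal.tsum_mul_left]
  refine ENNReal.tsum_le_tsum fun νm => ?_
  obtain ⟨ν, m⟩ := νm
  simp only [shiftReflect_apply]
  have h2 := hb j ν m (a ν m) (fun h => by rw [h]; exact ha0 m) (fun h => ha1 ν m h) x
  have h3 : ‖∫ y, invFourierS (φ j) (x - y) • a ν m y‖ₑ ≤ ENNReal.ofReal C *
      2 ^ (Ge s (n / p.toReal) n K (L + 1).toNat j ν) * wt (2 ^ (min j ν)) M (x - latPt ν m) := by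
    rw [← ofReal_norm_eq_enorm]
    refine (ENNReal.ofReal_le_ofReal h2).trans (le_of_eq ?_)
    have e1 : (2:ℝ) ^ (-(ν : ℝ) * (s - (n : ℝ) / p.toReal)) * Bfac n K (L + 1).toNat j ν
        = 2 ^ (Ge s (n / p.toReal) n K (L + 1).toNat j ν) := by
      unfold Bfac Ge
      split_ifs <;> rw [Real.rpow_add (by norm_num)]
    have e2 : ((2:ℝ≥0∞)) ^ (Ge s (n / p.toReal) n K (L + 1).toNat j ν)
        = ENNReal.ofReal (2 ^ (Ge s (n / p.toReal) n K (L + 1).toNat j ν)) := by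
      rw [← ENNReal.ofReal_rpow_of_pos (by norm_num)]
      simp
    rw [mul_assoc C, e1, e2, wt, ← ENNReal.ofReal_mul hC.le, ← ENNReal.ofReal_mul (by positivity),
      Real.rpow_neg (by positivity), Real.rpow_natCast]
  rw [enorm_smul]
  calc _ ≤ ‖κ‖ₑ * (‖lam ν m‖ₑ * (ENNReal.ofReal C *
      2 ^ (Ge s (n / p.toReal) n K (L + 1).toNat j ν) * wt (2 ^ (min j ν)) M (x - latPt ν m))) := by
        gcongr
    _ = ‖lam ν m‖ₑ * (‖κ‖ₑ * ENNReal.ofReal C * 2 ^ (Ge s (n / p.toReal) n K (L + 1).toNat j ν)) *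
        wt (2 ^ (min j ν)) M (x - latPt ν m) := by ring
    _ = _ := rfl
end PartF

/-- an atomic decomposition with `b_{p,q}`-coefficients lies in
`B^s_{p,q}(E)`, with norm controlled by `‖λ|b_{p,q}‖` uniformly in the representation. -/
theorem statement13 (n : ℕ) (E : Type*) [NormedAddCommGroup E] [NormedSpace ℂ E]
    [CompleteSpace E] (s : ℝ) (p q : ℝ≥0∞) (hp : 0 < p) (hq : 0 < q)
    (d : ℝ) (hd : 1 < d) (K : ℕ) (L : ℤ) (hL : -1 ≤ L)
    (hK : 1 + ⌊s⌋ ≤ (K : ℤ)) (hLs : ⌊sigmaP n p - s⌋ ≤ L)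
    (φ : ℕ → Sch n) (hφ : SmoothResolution n φ) :
    ∃ c > (0 : ℝ), ∀ (f : TDist n E) (lam : ℕ → (Fin n → ℤ) → ℂ)
        (a : ℕ → (Fin n → ℤ) → Rn n → E),
      (∀ m, Is1Atom K d m (a 0 m)) →
      (∀ ν m, 0 < ν → IsSPAtom s p K L d ν m (a ν m)) →
      bNorm p q lam < ∞ →
      RepresentsAtomic f lam a →
      besovNorm s p q φ f < ∞ ∧
        besovNorm s p q φ f ≤ ENNReal.ofReal c * bNorm p q lam := by
  set N := (L + 1).toNat with hN
  have hKs : s < K := by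
    have h1 := Int.lt_floor_add_one s
    have h2 : ((1 + ⌊s⌋ : ℤ) : ℝ) ≤ ((K : ℤ) : ℝ) := by exact_mod_cast hK
    push_cast at h2
    linarith
  have hNs : sigmaP n p - s < N := by
    have h1 := Int.lt_floor_add_one (sigmaP n p - s)
    have h2 : ((⌊sigmaP n p - s⌋ + 1 : ℤ) : ℝ) ≤ ((N : ℤ) : ℝ) := by
      have : ⌊sigmaP n p - s⌋ + 1 ≤ (N : ℤ) := by omega
      exact_mod_cast this
    push_cast at h2
    linarith
  obtain ⟨δ, hδ, hδ1, hδ2⟩ : ∃ δ : ℝ, 0 < δ ∧ δ ≤ K - s ∧ δ ≤ s + N - sigmaP n p :=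
    ⟨min (K - s) (s + N - sigmaP n p), lt_min (by linarith) (by linarith), min_le_left _ _,
      min_le_right _ _⟩
  obtain ⟨M, hM, hM'⟩ : ∃ M : ℕ, n < M ∧ (p ≠ ∞ → (n : ℝ) < M * p.toReal) := by
    obtain ⟨k, hk⟩ := exists_nat_gt ((n : ℝ) / p.toReal)
    refine ⟨max (n + 1) k, by simp, fun hpt => ?_⟩
    have ht : 0 < p.toReal := ENNReal.toReal_pos hp.ne' hpt
    rw [div_lt_iff₀ ht] at hk
    refine hk.trans_le ?_
    gcongr
    exact le_max_right _ _
  obtain ⟨C0, hC0, hpw⟩ := pointwise (E := E) hφ s p K L hL d hd M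
  obtain ⟨C, t, θ, hC, ht, hθ, hest⟩ := est_F (n := n) (E := E) s δ p hp K N M hδ hδ1 hδ2 hM hM' C0 hC0
  obtain ⟨C', hC', hy⟩ := discrete_young ht hθ q hq C hC
  refine ⟨C'.toReal + 1, by positivity, ?_⟩
  intro f lam a ha0 ha1 hlam hrep
  have hmain : besovNorm s p q φ f ≤ ENNReal.ofReal (C'.toReal + 1) * bNorm p q lam := by
    have h1 := hy (fun j => (2 : ℝ≥0∞) ^ ((j : ℝ) * s) * eLpNorm (mOp (φ j) f) p volume)
      (fun ν => lamNorm p fun m => (‖lam ν m‖₊ : ℝ≥0∞))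
      (fun j => hest j (mOp (φ j) f) (fun ν m => (‖lam ν m‖₊ : ℝ≥0∞))
        (hpw f lam a ha0 ha1 hrep j))
    refine le_trans h1 ?_
    refine mul_le_mul' ?_ le_rfl
    calc C' = ENNReal.ofReal C'.toReal := (ENNReal.ofReal_toReal hC').symm
      _ ≤ _ := ENNReal.ofReal_le_ofReal (by linarith)
  exact ⟨hmain.trans_lt (ENNReal.mul_lt_top ENNReal.ofReal_lt_top hlam), hmain⟩

end
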